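/- For every natural number k ≥ 2 there exists an infinite-dimensional separable real Banach space X such that the collection of norm-closed two-sided ideals J of the algebra L(X) of bounded linear operators on X satisfying {0} ≠ J ≠ L(X) is totally ordered by inclusion, has exactly k elements, and its least element is the ideal of compact operators on X. -/

import Mathlib

namespace Calkin

/-- The pair `(m j, n j)` of a rapidly increasing double sequence. -/
def growth : ℕ → ℕ × ℕ
  | 0 => (4, 2 * 4 ^ 2)
  | j + 1 =>
    ((growth j).2 ^ 2,
      2 * ((growth j).2 ^ 2) ^ 2 * (9 * (growth j).2) ^ (((growth j).2 ^ 2) ^ 2 + 1))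

/-- The reciprocals of the weights. -/
def mm (j : ℕ) : ℕ := (growth j).1

/-- The maximal ages. -/
def nn (j : ℕ) : ℕ := (growth j).2

/-- A bound for the lengths available to weights below `j`. -/
def qq : ℕ → ℕ
  | 0 => 1
  | j + 1 => 9 * nn j

lemma mm_succ (j : ℕ) : mm (j + 1) = nn j ^ 2 := rfl

lemma nn_eq (j : ℕ) : nn j = 2 * mm j ^ 2 * qq j ^ (mm j ^ 2 + 1) := by
  cases j with
  | zero => simp [nn, mm, qq, growth]
  | succ j => rfl

lemma pos_aux (j : ℕ) : 4 ≤ mm j ∧ 1 ≤ qq j ∧ 4 ≤ nn j := by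
  induction j with
  | zero => exact ⟨le_rfl, le_rfl, by simp [nn, growth]⟩
  | succ j ih =>
    obtain ⟨-, -, h⟩ := ih
    have h1 : 4 ≤ mm (j + 1) := by rw [mm_succ]; nlinarith
    have h2 : 1 ≤ qq (j + 1) := by show 1 ≤ 9 * nn j; omega
    refine ⟨h1, h2, ?_⟩
    rw [nn_eq]
    have : 1 ≤ qq (j + 1) ^ (mm (j + 1) ^ 2 + 1) := Nat.one_le_pow _ _ h2
    nlinarith [Nat.mul_le_mul (show 2 * 4 ^ 2 ≤ 2 * mm (j + 1) ^ 2 by gcongr) this]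

lemma four_le_mm (j : ℕ) : 4 ≤ mm j := (pos_aux j).1

lemma one_le_qq (j : ℕ) : 1 ≤ qq j := (pos_aux j).2.1

lemma nn_pos (j : ℕ) : 0 < nn j := by have := (pos_aux j).2.2; omega

lemma sq_mm_le_nn (j : ℕ) : mm j ^ 2 ≤ nn j := by
  rw [nn_eq]
  have : 1 ≤ qq j ^ (mm j ^ 2 + 1) := Nat.one_le_pow _ _ (one_le_qq j)
  nlinarith [Nat.zero_le (mm j ^ 2)]

lemma sq_mm_mul_le_nn (j : ℕ) : mm j ^ 2 * qq j ^ (mm j ^ 2 + 1) ≤ nn j := by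
  rw [nn_eq, mul_assoc]; omega

lemma even_nn (j : ℕ) : Even (nn j) := by
  rw [nn_eq, mul_assoc]; exact even_two_mul _

lemma mm_lt_succ (j : ℕ) : mm j < mm (j + 1) := by
  have h := sq_mm_le_nn j
  have h4 := four_le_mm j
  rw [mm_succ]
  have h1 : mm j < mm j ^ 2 := by nlinarith
  exact (h1.trans_le h).trans_le (Nat.le_self_pow two_ne_zero _)

lemma mm_strictMono : StrictMono mm := strictMono_nat_of_lt_succ mm_lt_succ

lemma nn_mono : Monotone nn := by
  refine monotone_nat_of_le_succ fun j => ?_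
  have h := sq_mm_le_nn (j + 1)
  rw [mm_succ] at h
  have := nn_pos j
  nlinarith [Nat.le_self_pow (n := 4) (by norm_num) (nn j), h]

lemma nine_nn_le_qq {h j : ℕ} (hj : h < j) : 9 * nn h ≤ qq j := by
  cases j with
  | zero => omega
  | succ j =>
    show 9 * nn h ≤ 9 * nn j
    exact Nat.mul_le_mul_left _ (nn_mono (by omega))

lemma sq_nn_le_mm {j c : ℕ} (h : j < c) : nn j ^ 2 ≤ mm c := by
  rw [← mm_succ]; exact mm_strictMono.monotone h

lemma sq_mm_le_mm {j c : ℕ} (h : j < c) : mm j ^ 2 ≤ mm c := by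
  refine le_trans ?_ (sq_nn_le_mm h)
  exact Nat.pow_le_pow_left ((Nat.le_self_pow two_ne_zero _).trans (sq_mm_le_nn j)) 2

/-- The weight function as a real number. -/
noncomputable def ww (j : ℕ) : ℝ := (mm j : ℝ)⁻¹

lemma mm_pos (j : ℕ) : (0 : ℝ) < mm j := by
  have := four_le_mm j; exact_mod_cast (by omega : 0 < mm j)

lemma nnr_pos (j : ℕ) : (0 : ℝ) < nn j := by exact_mod_cast nn_pos j

lemma ww_pos (j : ℕ) : 0 < ww j := inv_pos.2 (mm_pos j)

lemma ww_le (j : ℕ) : ww j ≤ 1 / 4 := by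
  rw [ww, one_div]
  exact inv_anti₀ (by norm_num) (by exact_mod_cast four_le_mm j)

lemma ww_anti {i j : ℕ} (h : i ≤ j) : ww j ≤ ww i :=
  inv_anti₀ (mm_pos i) (by exact_mod_cast mm_strictMono.monotone h)

lemma ww_mul_mm (j : ℕ) : ww j * mm j = 1 := inv_mul_cancel₀ (mm_pos j).ne'

/-- The data coded by a natural number. -/
def data (γ : ℕ) : ℕ × ℕ × ℕ × ℕ :=
  ((Nat.unpair (Nat.unpair γ).2).1,
    (Nat.unpair (Nat.unpair (Nat.unpair γ).2).2).1,
    (Nat.unpair (Nat.unpair (Nat.unpair (Nat.unpair γ).2).2).2).1,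
    (Nat.unpair (Nat.unpair (Nat.unpair (Nat.unpair γ).2).2).2).2)

lemma exists_data (t : ℕ × ℕ × ℕ × ℕ) (B : ℕ) : ∃ γ, B ≤ γ ∧ data γ = t :=
  ⟨Nat.pair B (Nat.pair t.1 (Nat.pair t.2.1 (Nat.pair t.2.2.1 t.2.2.2))),
    Nat.left_le_pair _ _, by simp [data]⟩

lemma data_snd_le (γ : ℕ) : (data γ).2.1 ≤ γ :=
  (Nat.unpair_left_le _).trans ((Nat.unpair_right_le _).trans (Nat.unpair_right_le _))

open Classical in
/-- Weight, age and predecessor data of an index. -/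
noncomputable def info (γ : ℕ) : ℕ × ℕ × Option (ℕ × ℕ × ℕ) :=
  if h : (data γ).2.1 < (data γ).2.2.1 ∧ (data γ).2.2.1 < γ ∧ (data γ).2.2.2 < γ then
    if (data γ).1 = 1 ∧ (info (data γ).2.1).2.1 + 1 ≤ nn (info (data γ).2.1).1 ∧
        (Odd (info (data γ).2.1).1 → (info (data γ).2.2.2).1 = 2 * (data γ).2.1 + 2) then
      ((info (data γ).2.1).1, (info (data γ).2.1).2.1 + 1, some (data γ).2)
    else (if (data γ).1 = 0 then (data γ).2.1 else 0, 0, none)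
  else (if (data γ).1 = 0 then (data γ).2.1 else 0, 0, none)
termination_by γ
decreasing_by
  all_goals omega

/-- The index of the weight. -/
noncomputable def wt (γ : ℕ) : ℕ := (info γ).1

/-- The age. -/
noncomputable def age (γ : ℕ) : ℕ := (info γ).2.1

/-- The predecessor data `(ξ, p, η)`. -/
noncomputable def pred (γ : ℕ) : Option (ℕ × ℕ × ℕ) := (info γ).2.2

lemma pred_spec {γ ξ p η : ℕ} (h : pred γ = some (ξ, p, η)) :
    ξ < p ∧ p < γ ∧ η < γ ∧ wt γ = wt ξ ∧ age γ = age ξ + 1 ∧ age ξ + 1 ≤ nn (wt ξ) ∧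
      (Odd (wt ξ) → wt η = 2 * ξ + 2) := by
  unfold pred at h
  unfold wt age
  rw [info] at h
  conv => enter [2, 2, 2]; rw [info]
  split_ifs at h with h1 h2
  · simp only [Option.some.injEq] at h
    rw [h] at h1 h2
    simp only [h, dif_pos h1, if_pos h2]
    exact ⟨h1.1, h1.2.1, h1.2.2, trivial, trivial, h2.2.1, h2.2.2⟩

lemma wt_le_of_pred_eq_none {γ : ℕ} (h : pred γ = none) : wt γ ≤ γ ∧ age γ = 0 := by
  have h0 := data_snd_le γ
  unfold pred at h
  unfold wt age
  rw [info] at h ⊢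
  split_ifs at h ⊢ <;> simp_all

lemma wt_le (γ : ℕ) : wt γ ≤ γ := by
  induction γ using Nat.strong_induction_on with
  | _ γ ih =>
    rcases h : pred γ with _ | ⟨ξ, p, η⟩
    · exact (wt_le_of_pred_eq_none h).1
    · obtain ⟨h1, h2, -, h3, -⟩ := pred_spec h
      have := ih ξ (by omega)
      omega

lemma age_le (γ : ℕ) : age γ ≤ nn (wt γ) := by
  rcases h : pred γ with _ | ⟨ξ, p, η⟩
  · rw [(wt_le_of_pred_eq_none h).2]; exact Nat.zero_le _
  · obtain ⟨-, -, -, h3, h4, h5, -⟩ := pred_spec h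
    rw [h3, h4]; exact h5

lemma exists_root (j B : ℕ) : ∃ γ, B ≤ γ ∧ wt γ = j ∧ age γ = 0 ∧ pred γ = none := by
  obtain ⟨γ, hγ, h⟩ := exists_data (0, j, 0, 0) B
  refine ⟨γ, hγ, ?_⟩
  unfold wt age pred
  rw [info]
  simp [h]

lemma exists_succ {ξ p η : ℕ} (h1 : ξ < p) (h2 : age ξ + 1 ≤ nn (wt ξ))
    (h3 : Odd (wt ξ) → wt η = 2 * ξ + 2) (B : ℕ) :
    ∃ γ, B ≤ γ ∧ pred γ = some (ξ, p, η) := by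
  obtain ⟨γ, hγ, h⟩ := exists_data (1, ξ, p, η) (B + p + η + 1)
  refine ⟨γ, by omega, ?_⟩
  unfold wt age at *
  unfold pred
  rw [info]
  simp only [h]
  rw [dif_pos ⟨h1, by omega, by omega⟩, if_pos ⟨trivial, h2, h3⟩]

open Filter Topology

variable {V : Type} [NormedAddCommGroup V] [NormedSpace ℝ V]

section Extension

variable (u : V →L[ℝ] V)

/-- The extension to all coordinates of the values `y γ`, `γ < p`. -/
noncomputable def Rv (p : ℕ) (y : ℕ → V) (γ : ℕ) : V :=
  if γ < p then y γ
  else match _h : pred γ with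
    | none => 0
    | some (ξ, q, η) =>
      Rv p y ξ + if q < p then ww (wt γ) • u (Rv p y η - Rv q y η) else 0
termination_by γ
decreasing_by
  all_goals
    obtain ⟨h1, h2, h3, -⟩ := pred_spec _h
    omega

variable {u}

lemma Rv_lt {p γ : ℕ} (y : ℕ → V) (h : γ < p) : Rv u p y γ = y γ := by
  rw [Rv, if_pos h]

lemma Rv_root {p γ : ℕ} (y : ℕ → V) (h : p ≤ γ) (hγ : pred γ = none) : Rv u p y γ = 0 := by
  rw [Rv, if_neg h.not_gt]
  split
  · rfl
  · simp_all

lemma Rv_succ {p γ ξ q η : ℕ} (y : ℕ → V) (h : p ≤ γ) (hγ : pred γ = some (ξ, q, η)) :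
    Rv u p y γ =
      Rv u p y ξ + if q < p then ww (wt γ) • u (Rv u p y η - Rv u q y η) else 0 := by
  rw [Rv, if_neg h.not_gt]
  split
  · simp_all
  · rename_i h'
    rw [hγ] at h'
    simp only [Option.some.injEq, Prod.mk.injEq] at h'
    obtain ⟨rfl, rfl, rfl⟩ := h'
    rfl

/-- Induction along the predecessor structure. -/
lemma pred_induction {Q : ℕ → Prop} (hroot : ∀ γ, pred γ = none → Q γ)
    (hsucc : ∀ γ ξ p η, pred γ = some (ξ, p, η) → (∀ γ' < γ, Q γ') → Q γ) (γ : ℕ) : Q γ := by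
  induction γ using Nat.strong_induction_on with
  | _ γ ih =>
    rcases h : pred γ with _ | ⟨ξ, p, η⟩
    · exact hroot γ h
    · exact hsucc γ ξ p η h ih

lemma Rv_add (p : ℕ) (y z : ℕ → V) (γ : ℕ) :
    Rv u p (y + z) γ = Rv u p y γ + Rv u p z γ := by
  induction γ using pred_induction generalizing p with
  | hroot γ h =>
    rcases lt_or_ge γ p with h1 | h1
    · simp [Rv_lt _ h1]
    · simp [Rv_root _ h1 h]
  | hsucc γ ξ q η h ih =>
    rcases lt_or_ge γ p with h1 | h1
    · simp [Rv_lt _ h1]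
    · obtain ⟨h2, h3, h4, -⟩ := pred_spec h
      rw [Rv_succ _ h1 h, Rv_succ _ h1 h, Rv_succ _ h1 h, ih ξ (by omega), ih η h4, ih η h4]
      split_ifs
      · simp only [map_sub, map_add, smul_sub, smul_add]; abel
      · abel

lemma Rv_smul (p : ℕ) (c : ℝ) (y : ℕ → V) (γ : ℕ) :
    Rv u p (c • y) γ = c • Rv u p y γ := by
  induction γ using pred_induction generalizing p with
  | hroot γ h =>
    rcases lt_or_ge γ p with h1 | h1
    · simp [Rv_lt _ h1]
    · simp [Rv_root _ h1 h]
  | hsucc γ ξ q η h ih =>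
    rcases lt_or_ge γ p with h1 | h1
    · simp [Rv_lt _ h1]
    · obtain ⟨h2, h3, h4, -⟩ := pred_spec h
      rw [Rv_succ _ h1 h, Rv_succ _ h1 h, ih ξ (by omega), ih η h4, ih η h4, smul_add]
      split_ifs
      · rw [← smul_sub, map_smul, smul_comm]
      · simp

lemma Rv_comm {M : V →L[ℝ] V} (hM : ∀ v, M (u v) = u (M v)) (p : ℕ) (y : ℕ → V) (γ : ℕ) :
    Rv u p (fun δ => M (y δ)) γ = M (Rv u p y γ) := by
  induction γ using pred_induction generalizing p with
  | hroot γ h =>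
    rcases lt_or_ge γ p with h1 | h1
    · simp [Rv_lt _ h1]
    · simp [Rv_root _ h1 h]
  | hsucc γ ξ q η h ih =>
    rcases lt_or_ge γ p with h1 | h1
    · simp [Rv_lt _ h1]
    · obtain ⟨h2, h3, h4, -⟩ := pred_spec h
      rw [Rv_succ _ h1 h, Rv_succ _ h1 h, ih ξ (by omega), ih η h4, ih η h4, map_add]
      split_ifs
      · simp only [map_smul, hM, map_sub]
      · simp

lemma Rv_congr (p : ℕ) {y z : ℕ → V} (hyz : ∀ γ < p, y γ = z γ) (γ : ℕ) :
    Rv u p y γ = Rv u p z γ := by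
  induction γ using pred_induction generalizing p with
  | hroot γ h =>
    rcases lt_or_ge γ p with h1 | h1
    · simp [Rv_lt _ h1, hyz γ h1]
    · simp [Rv_root _ h1 h]
  | hsucc γ ξ q η h ih =>
    rcases lt_or_ge γ p with h1 | h1
    · simp [Rv_lt _ h1, hyz γ h1]
    · obtain ⟨h2, h3, h4, -⟩ := pred_spec h
      rw [Rv_succ _ h1 h, Rv_succ _ h1 h, ih ξ (by omega) p hyz]
      split_ifs with h5
      · rw [ih η h4 p hyz, ih η h4 q fun γ hγ => hyz γ (by omega)]
      · rfl

lemma Rv_Rv (p q : ℕ) (y : ℕ → V) (γ : ℕ) :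
    Rv u p (Rv u q y) γ = Rv u (min p q) y γ := by
  induction γ using pred_induction generalizing p q with
  | hroot γ h =>
    rcases lt_or_ge γ p with h1 | h1
    · rw [Rv_lt _ h1]
      rcases lt_or_ge γ q with h2 | h2
      · rw [Rv_lt _ h2, Rv_lt _ (lt_min h1 h2)]
      · rw [Rv_root _ h2 h, Rv_root _ (min_le_of_right_le h2) h]
    · rw [Rv_root _ h1 h, Rv_root _ (min_le_of_left_le h1) h]
  | hsucc γ ξ r η h ih =>
    obtain ⟨h2, h3, h4, -⟩ := pred_spec h
    rcases lt_or_ge γ p with h1 | h1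
    · rw [Rv_lt _ h1]
      rcases le_total p q with h5 | h5
      · rw [min_eq_left h5, Rv_lt _ h1, Rv_lt _ (by omega)]
      · rw [min_eq_right h5]
    · rw [Rv_succ _ h1 h, ih ξ (by omega), ih η h4, ih η h4, Rv_succ _ (min_le_of_left_le h1) h]
      congr 1
      by_cases h6 : r < min p q
      · rw [if_pos h6, if_pos (h6.trans_le (min_le_left _ _)), min_eq_left (a := r)]
        exact h6.le.trans (min_le_right _ _)
      · rw [if_neg h6]
        split_ifs with h7
        · have : min r q = min p q := by omega
          rw [this, sub_self, map_zero, smul_zero]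
        · rfl

lemma norm_u_le (hu : ‖u‖ ≤ 1) (v : V) : ‖u v‖ ≤ ‖v‖ := by
  simpa using u.le_of_opNorm_le hu v

lemma Rv_norm_le [hu : Fact (‖u‖ ≤ 1)] {p : ℕ} {y : ℕ → V} {B : ℝ} (hB : 0 ≤ B)
    (h : ∀ γ < p, ‖y γ‖ ≤ B) (γ : ℕ) : ‖Rv u p y γ‖ ≤ 2 * B := by
  induction γ using pred_induction generalizing p with
  | hroot γ h0 =>
    rcases lt_or_ge γ p with h1 | h1
    · rw [Rv_lt _ h1]; linarith [h γ h1]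
    · rw [Rv_root _ h1 h0]; simpa using hB
  | hsucc γ ξ q η h0 ih =>
    rcases lt_or_ge γ p with h1 | h1
    · rw [Rv_lt _ h1]; linarith [h γ h1]
    · obtain ⟨h2, h3, h4, -⟩ := pred_spec h0
      rw [Rv_succ _ h1 h0]
      split_ifs with h5
      · have e1 : ‖Rv u p y ξ‖ ≤ B := by rw [Rv_lt _ (h2.trans h5)]; exact h ξ (h2.trans h5)
        have e2 := ih η h4 h
        have e3 := ih η h4 (p := q) fun γ hγ => h γ (by omega)
        have e4 := norm_u_le hu.out (Rv u p y η - Rv u q y η)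
        have e5 := norm_sub_le (Rv u p y η) (Rv u q y η)
        have e6 : ‖ww (wt γ) • u (Rv u p y η - Rv u q y η)‖ ≤ 1 / 4 * (4 * B) := by
          rw [norm_smul, Real.norm_of_nonneg (ww_pos _).le]
          exact mul_le_mul (ww_le _) (by linarith) (norm_nonneg _) (by norm_num)
        linarith [norm_add_le (Rv u p y ξ) (ww (wt γ) • u (Rv u p y η - Rv u q y η))]
      · rw [add_zero]; exact ih ξ (by omega) h

variable (u) in
/-- The extension as a bounded function. -/
noncomputable def mkB [hu : Fact (‖u‖ ≤ 1)] (q : ℕ) (y : ℕ → V) :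
    BoundedContinuousFunction ℕ V :=
  BoundedContinuousFunction.ofNormedAddCommGroupDiscrete (Rv u q y)
    (2 * ∑ i ∈ Finset.range q, ‖y i‖)
    (Rv_norm_le (Finset.sum_nonneg fun _ _ => norm_nonneg _) fun _ hγ =>
      Finset.single_le_sum (f := fun i => ‖y i‖) (fun _ _ => norm_nonneg _)
        (Finset.mem_range.2 hγ))

variable [hu : Fact (‖u‖ ≤ 1)]

@[simp]
lemma mkB_add (q : ℕ) (y z : ℕ → V) : mkB u q (y + z) = mkB u q y + mkB u q z := by
  ext γ; exact Rv_add q y z γ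

lemma mkB_smul (q : ℕ) (c : ℝ) (y : ℕ → V) : mkB u q (c • y) = c • mkB u q y := by
  ext γ; exact Rv_smul q c y γ

lemma mkB_norm_le (q : ℕ) (x : BoundedContinuousFunction ℕ V) : ‖mkB u q x‖ ≤ 2 * ‖x‖ := by
  rw [BoundedContinuousFunction.norm_le (by positivity)]
  exact Rv_norm_le (norm_nonneg _) fun γ _ => x.norm_coe_le_norm γ

end Extension

section Space

variable (u : V →L[ℝ] V) [hu : Fact (‖u‖ ≤ 1)]

/-- The underlying subspace of bounded sequences. -/
noncomputable def XSub : Submodule ℝ (BoundedContinuousFunction ℕ V) where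
  carrier := {x | Tendsto (fun n => mkB u n x) atTop (𝓝 x)}
  add_mem' {x y} hx hy := by
    have := hx.add hy
    simp only [← mkB_add] at this
    exact this
  zero_mem' := by
    have h (n : ℕ) : mkB u n (0 : ℕ → V) = 0 := by
      simpa using mkB_smul (u := u) n 0 (0 : ℕ → V)
    show Tendsto (fun n => mkB u n (0 : ℕ → V)) atTop (𝓝 0)
    simp [h]
  smul_mem' c x hx := by
    have := hx.const_smul c
    simp only [← mkB_smul] at this
    exact this

/-- The Banach space. -/
abbrev X : Type := XSub u

variable {u}

lemma isClosed_XSub : IsClosed (XSub u : Set (BoundedContinuousFunction ℕ V)) := by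
  rw [← isSeqClosed_iff_isClosed]
  intro x y hx hxy
  show Tendsto _ _ _
  rw [Metric.tendsto_atTop]
  intro ε hε
  obtain ⟨i, hi⟩ := (Metric.tendsto_atTop.1 hxy (ε / 4) (by positivity))
  have hi := hi i le_rfl
  obtain ⟨N, hN⟩ := Metric.tendsto_atTop.1 (show Tendsto _ _ _ from hx i) (ε / 4) (by positivity)
  refine ⟨N, fun n hn => ?_⟩
  have h1 := hN n hn
  rw [dist_eq_norm] at hi h1 ⊢
  have h2 : mkB u n y - y = (mkB u n (x i) - x i) -
      mkB u n (x i - y : BoundedContinuousFunction ℕ V)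
      + (x i - y) := by
    have : mkB u n (x i) = mkB u n (x i - y : BoundedContinuousFunction ℕ V) + mkB u n y := by
      rw [← mkB_add]
      congr 1
      ext γ
      simp
    rw [this]; abel
  have h3 := mkB_norm_le (u := u) n (x i - y)
  rw [h2]
  linarith [norm_add_le ((mkB u n (x i) - x i) -
    mkB u n (x i - y : BoundedContinuousFunction ℕ V)) (x i - y),
    norm_sub_le (mkB u n (x i) - x i) (mkB u n (x i - y : BoundedContinuousFunction ℕ V))]

instance [CompleteSpace V] : CompleteSpace (X u) := isClosed_XSub.completeSpace_coe

lemma mkB_mem (q : ℕ) (y : ℕ → V) : mkB u q y ∈ XSub u := by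
  show Tendsto _ _ _
  refine tendsto_const_nhds.congr' ?_
  filter_upwards [eventually_ge_atTop q] with n hn
  ext γ
  show _ = Rv u n (Rv u q y) γ
  rw [Rv_Rv, min_eq_right hn]; rfl

/-- The extension as a linear map into the space. -/
noncomputable def mkX (q : ℕ) : (ℕ → V) →ₗ[ℝ] X u where
  toFun y := ⟨mkB u q y, mkB_mem q y⟩
  map_add' y z := Subtype.ext (mkB_add q y z)
  map_smul' c y := Subtype.ext (mkB_smul q c y)

/-- The coordinates. -/
noncomputable def e (γ : ℕ) : X u →L[ℝ] V :=
  (BoundedContinuousFunction.evalCLM ℝ γ).comp (XSub u).subtypeL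

lemma e_mkX (q γ : ℕ) (y : ℕ → V) : e γ (mkX (u := u) q y) = Rv u q y γ := rfl

lemma ext_e {x y : X u} (h : ∀ γ, e γ x = e γ y) : x = y :=
  Subtype.ext (BoundedContinuousFunction.ext h)

lemma norm_e_le (γ : ℕ) (x : X u) : ‖e γ x‖ ≤ ‖x‖ := x.1.norm_coe_le_norm γ

lemma norm_le_of {x : X u} {C : ℝ} (hC : 0 ≤ C) (h : ∀ γ, ‖e γ x‖ ≤ C) : ‖x‖ ≤ C :=
  (BoundedContinuousFunction.norm_le hC).2 h

/-- The projections. -/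
noncomputable def P (n : ℕ) : X u →L[ℝ] X u :=
  LinearMap.mkContinuous
    { toFun := fun x => mkX n fun γ => e γ x
      map_add' := fun x y => by rw [← map_add]; congr 1
      map_smul' := fun c x => by rw [← map_smul]; congr 1 } 2 fun x => mkB_norm_le n x.1

lemma P_eq (n : ℕ) (x : X u) : P n x = mkX n fun γ => e γ x := rfl

lemma norm_P_le (n : ℕ) (x : X u) : ‖P n x‖ ≤ 2 * ‖x‖ := mkB_norm_le n x.1

lemma e_P_lt {n γ : ℕ} (h : γ < n) (x : X u) : e γ (P n x) = e γ x := Rv_lt _ h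

lemma P_mkX (m n : ℕ) (y : ℕ → V) : P m (mkX n y) = mkX (u := u) (min m n) y :=
  ext_e fun γ => Rv_Rv m n y γ

lemma P_P (m n : ℕ) (x : X u) : P m (P n x) = P (min m n) x := P_mkX m n _

lemma tendsto_P (x : X u) : Tendsto (fun n => P n x) atTop (𝓝 x) := by
  rw [tendsto_subtype_rng]
  exact x.2

lemma P_of_le {m n : ℕ} {x : X u} (h : m ≤ n) (hx : P m x = x) : P n x = x := by
  rw [← hx, P_P, min_eq_right h]

lemma P_eq_zero_of_le {m n : ℕ} {x : X u} (h : m ≤ n) (hx : P n x = 0) : P m x = 0 := by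
  have := P_P m n x
  rw [hx, map_zero, min_eq_left h] at this
  exact this.symm

lemma e_P_root {n γ : ℕ} (h : n ≤ γ) (hγ : pred γ = none) (x : X u) : e γ (P n x) = 0 :=
  Rv_root _ h hγ

lemma e_P_succ {n γ ξ q η : ℕ} (h : n ≤ γ) (hγ : pred γ = some (ξ, q, η)) (x : X u) :
    e γ (P n x) = e ξ (P n x) +
      if q < n then ww (wt γ) • u (e η (P n x) - e η (P q x)) else 0 :=
  Rv_succ _ h hγ

/-- The functionals biorthogonal to the basis. -/
noncomputable def d (γ : ℕ) : X u →L[ℝ] V := e γ - (e γ).comp (P γ)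

lemma d_apply (γ : ℕ) (x : X u) : d γ x = e γ x - e γ (P γ x) := rfl

lemma e_root {γ : ℕ} (hγ : pred γ = none) (x : X u) : e γ x = d γ x := by
  rw [d_apply, e_P_root le_rfl hγ, sub_zero]

lemma e_succ {γ ξ p η : ℕ} (hγ : pred γ = some (ξ, p, η)) (x : X u) :
    e γ x = d γ x + e ξ x + ww (wt γ) • u (e η x - e η (P p x)) := by
  obtain ⟨h1, h2, h3, -⟩ := pred_spec hγ
  rw [d_apply, e_P_succ le_rfl hγ, if_pos h2, e_P_lt (h1.trans h2), e_P_lt h3]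
  abel

lemma norm_d_le (γ : ℕ) (x : X u) : ‖d γ x‖ ≤ 3 * ‖x‖ := by
  rw [d_apply]
  linarith [norm_sub_le (e γ x) (e γ (P γ x)), norm_e_le γ x, norm_e_le γ (P γ x), norm_P_le γ x]

lemma tendsto_d (x : X u) : Tendsto (fun γ => d γ x) atTop (𝓝 0) := by
  have h : Tendsto (fun γ => ‖x - P γ x‖) atTop (𝓝 0) := by
    simpa using ((tendsto_const_nhds (x := x)).sub (tendsto_P x)).norm
  refine squeeze_zero_norm (fun γ => ?_) h
  rw [d_apply, ← map_sub]
  exact norm_e_le _ _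

lemma d_eq_zero_of_P_eq {n γ : ℕ} {x : X u} (hx : P n x = x) (h : n ≤ γ) : d γ x = 0 := by
  rw [d_apply, P_of_le h hx, sub_self]

lemma e_eq_zero_of_lt {n γ : ℕ} {x : X u} (hx : P n x = 0) (h : γ < n) : e γ x = 0 := by
  rw [← e_P_lt h, hx, map_zero]

lemma d_eq_zero_of_lt {n γ : ℕ} {x : X u} (hx : P n x = 0) (h : γ < n) : d γ x = 0 := by
  rw [d_apply, e_eq_zero_of_lt hx h, P_eq_zero_of_le h.le hx, map_zero, sub_zero]

lemma e_eq_zero_of_le_wt {t γ : ℕ} {x : X u} (hx : P t x = x) (h : t ≤ wt γ) : e γ x = 0 := by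
  induction γ using pred_induction with
  | hroot γ hγ => rw [e_root hγ, d_eq_zero_of_P_eq hx (h.trans (wt_le γ))]
  | hsucc γ ξ p η hγ ih =>
    obtain ⟨h1, h2, h3, h4, -⟩ := pred_spec hγ
    have := wt_le ξ
    rw [e_succ hγ, d_eq_zero_of_P_eq hx (h.trans (wt_le γ)), ih ξ (by omega) (by omega),
      P_of_le (by omega) hx]
    simp

open Classical in
/-- The basis vectors. -/
noncomputable def b (γ : ℕ) : V →ₗ[ℝ] X u := (mkX (γ + 1)).comp (LinearMap.single ℝ (fun _ => V) γ)

lemma e_b (γ : ℕ) (v : V) : e γ (b (u := u) γ v) = v := by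
  rw [b, LinearMap.comp_apply, e_mkX, Rv_lt _ (Nat.lt_succ_self γ)]; simp

lemma P_b (γ : ℕ) (v : V) : P (γ + 1) (b (u := u) γ v) = b γ v := by
  rw [b, LinearMap.comp_apply, P_mkX, min_self]

lemma P_b_zero {n γ : ℕ} (h : n ≤ γ) (v : V) : P n (b (u := u) γ v) = 0 := by
  rw [b, LinearMap.comp_apply, P_mkX, min_eq_left (by omega)]
  refine ext_e fun δ => ?_
  rw [e_mkX, Rv_congr (z := 0)]
  · simpa using Rv_smul (u := u) n 0 (0 : ℕ → V) δ
  · intro δ hδ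
    simp [show δ ≠ γ by omega]

lemma norm_b_le (γ : ℕ) (v : V) : ‖b (u := u) γ v‖ ≤ 2 * ‖v‖ := by
  refine norm_le_of (by positivity) fun δ => Rv_norm_le (norm_nonneg v) (fun δ _ => ?_) δ
  rw [LinearMap.coe_single, Pi.single_apply]
  split_ifs <;> simp

lemma exists_factor_P (n : ℕ) : ∃ f : (Fin n → V) →ₗ[ℝ] X u,
    (∀ x, P n x = f fun i => e i x) ∧ ∀ y, P n (f y) = f y := by
  refine ⟨(mkX n).comp (LinearMap.pi fun i => if h : i < n then LinearMap.proj ⟨i, h⟩ else 0),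
    fun x => ext_e fun γ => ?_, fun y => by rw [LinearMap.comp_apply, P_mkX, min_self]⟩
  rw [LinearMap.comp_apply, P_eq, e_mkX, e_mkX]
  refine Rv_congr _ (fun γ h => ?_) γ
  simp [h]

/-- The coordinatewise operator induced by an operator commuting with `u`. -/
noncomputable def hat (M : V →L[ℝ] V) (hM : ∀ v, M (u v) = u (M v)) : X u →L[ℝ] X u :=
  ((M.compLeftContinuousBounded ℕ).comp (XSub u).subtypeL).codRestrict (XSub u) fun x => by
    have h : Tendsto (fun n => M.compLeftContinuousBounded ℕ (mkB u n x.1)) atTop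
        (𝓝 (M.compLeftContinuousBounded ℕ x.1)) :=
      ((M.compLeftContinuousBounded ℕ).continuous.tendsto _).comp x.2
    refine h.congr fun n => BoundedContinuousFunction.ext fun γ => ?_
    exact (Rv_comm hM n x.1 γ).symm

@[simp]
lemma e_hat {M : V →L[ℝ] V} (hM : ∀ v, M (u v) = u (M v)) (γ : ℕ) (x : X u) :
    e γ (hat M hM x) = M (e γ x) := rfl

lemma eq_zero_of_isCompactOperator_hat {M : V →L[ℝ] V} (hM : ∀ v, M (u v) = u (M v))
    (h : IsCompactOperator (hat M hM)) : M = 0 := by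
  ext v
  by_contra h0
  have hv : 0 < ‖M v‖ := norm_pos_iff.2 h0
  obtain ⟨K, hK, hK'⟩ := h.image_closedBall_subset_compact (2 * ‖v‖)
  obtain ⟨a, -, φ, hφ, ha⟩ := hK.tendsto_subseq (x := fun γ => hat M hM (b γ v))
    fun γ => hK' ⟨_, by simpa using norm_b_le γ v, rfl⟩
  obtain ⟨N, hN⟩ := Metric.cauchySeq_iff.1 ha.cauchySeq _ hv
  have h1 := hN N le_rfl (N + 1) (Nat.le_succ _)
  rw [Function.comp_apply, Function.comp_apply, dist_eq_norm, ← map_sub] at h1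
  have h2 := norm_e_le (φ N) (hat M hM (b (φ N) v - b (φ (N + 1)) v))
  have h3 : e (φ N) (b (u := u) (φ (N + 1)) v) = 0 :=
    e_eq_zero_of_lt (P_b_zero le_rfl v) (hφ (Nat.lt_succ_self N))
  rw [e_hat, map_sub, e_b, h3, sub_zero] at h2
  linarith

variable [FiniteDimensional ℝ V]

instance : TopologicalSpace.SeparableSpace (X u) := by
  have : FiniteDimensional ℝ V := inferInstance
  have : ProperSpace V := FiniteDimensional.proper ℝ V
  rw [← TopologicalSpace.isSeparable_univ_iff]
  have h : TopologicalSpace.IsSeparable (⋃ n, Set.range (P (u := u) n)) := by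
    refine TopologicalSpace.IsSeparable.iUnion fun n => ?_
    obtain ⟨f, hf, -⟩ := exists_factor_P (u := u) n
    refine (TopologicalSpace.isSeparable_range f.continuous_of_finiteDimensional).mono ?_
    rintro _ ⟨x, rfl⟩
    exact ⟨_, (hf x).symm⟩
  refine h.closure.mono fun x _ => ?_
  exact mem_closure_of_tendsto (tendsto_P x)
    (Eventually.of_forall fun n => Set.mem_iUnion.2 ⟨n, x, rfl⟩)

lemma isCompactOperator_P (n : ℕ) : IsCompactOperator (P (u := u) n) := by
  have : ProperSpace V := FiniteDimensional.proper ℝ V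
  obtain ⟨f, hf, -⟩ := exists_factor_P (u := u) n
  have h : IsCompactOperator ((LinearMap.toContinuousLinearMap f).comp
      (ContinuousLinearMap.pi fun i : Fin n => e (u := u) i)) :=
    (isCompactOperator_of_locallyCompactSpace_dom
      (ContinuousLinearMap.pi fun i : Fin n => e (u := u) i)).clm_comp _
  convert h using 1
  ext1 x
  exact hf x

end Space

open Finset

lemma norm_sum_le_of_exception {E : Type*} [SeminormedAddCommGroup E] {S : Finset ℕ} {f : ℕ → E}
    {κ : ℕ} {A B : ℝ} (hB : 0 ≤ B) (hA : ∀ k ∈ S, k ≠ κ → ‖f k‖ ≤ A)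
    (hκ : κ ∈ S → ‖f κ‖ ≤ A + B) : ‖∑ k ∈ S, f k‖ ≤ A * #S + B := by
  have h1 : ∀ k ∈ S, ‖f k‖ ≤ A + if k = κ then B else 0 := by
    intro k hk
    split_ifs with h
    · subst h; exact hκ hk
    · rw [add_zero]; exact hA k hk h
  refine (norm_sum_le_of_le S h1).trans ?_
  rw [sum_add_distrib, sum_const, nsmul_eq_mul, sum_ite_eq']
  split_ifs <;> linarith

section Estimates

variable {V : Type} [NormedAddCommGroup V] [NormedSpace ℝ V] {u : V →L[ℝ] V}
  [hu : Fact (‖u‖ ≤ 1)]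

/-- Successive blocks. -/
structure Blocks (s : ℕ → ℕ) (x : ℕ → X u) : Prop where
  mono : StrictMono s
  left : ∀ k, P (s k) (x k) = 0
  right : ∀ k, P (s (k + 1)) (x k) = x k

lemma exists_exception {s : ℕ → ℕ} (hs : StrictMono s) (p : ℕ) :
    ∃ κ, (∀ k < κ, s (k + 1) ≤ p) ∧ ∀ k, κ < k → p < s k := by
  classical
  have h : ∃ k, p < s (k + 1) := ⟨p, (Nat.lt_succ_self p).trans_le hs.le_apply⟩
  exact ⟨Nat.find h, fun k hk => not_lt.1 (Nat.find_min h hk),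
    fun k hk => (Nat.find_spec h).trans_le (hs.monotone hk)⟩

lemma norm_e_P_le {h p : ℕ} {x : X u} {B : ℝ} (hB : 0 ≤ B)
    (hx : ∀ γ < p, wt γ = h → ‖e γ x‖ ≤ B) {γ : ℕ} (hγ : wt γ = h) :
    ‖e γ (P p x)‖ ≤ B + 4 * ww h * ‖x‖ := by
  have h0 : 0 ≤ 4 * ww h * ‖x‖ := by have := (ww_pos h).le; positivity
  induction γ using pred_induction with
  | hroot γ h1 =>
    rcases lt_or_ge γ p with h2 | h2
    · rw [e_P_lt h2]; linarith [hx γ h2 hγ]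
    · rw [e_P_root h2 h1, norm_zero]; positivity
  | hsucc γ ξ q η h1 ih =>
    obtain ⟨h3, h4, h5, h6, -⟩ := pred_spec h1
    rcases lt_or_ge γ p with h2 | h2
    · rw [e_P_lt h2]; linarith [hx γ h2 hγ]
    · rw [e_P_succ h2 h1]
      split_ifs with h7
      · have e1 : ‖e ξ (P p x)‖ ≤ B := by
          rw [e_P_lt (h3.trans h7)]; exact hx ξ (h3.trans h7) (h6.symm.trans hγ)
        have e2 : ‖u (e η (P p x) - e η (P q x))‖ ≤ 4 * ‖x‖ := by
          refine (norm_u_le hu.out _).trans ((norm_sub_le _ _).trans ?_)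
          linarith [norm_e_le η (P p x), norm_e_le η (P q x), norm_P_le p x, norm_P_le q x]
        refine (norm_add_le _ _).trans (add_le_add e1 ?_)
        rw [norm_smul, Real.norm_of_nonneg (ww_pos _).le, hγ]
        nlinarith [ww_pos h]
      · rw [add_zero]; exact ih ξ (by omega) (h6.symm.trans hγ)

lemma norm_d_le_of_wt {h γ : ℕ} {x : X u} {B : ℝ} (hB : 0 ≤ B)
    (hx : ∀ γ, wt γ = h → ‖e γ x‖ ≤ B) (hγ : wt γ = h) :
    ‖d γ x‖ ≤ 2 * B + 4 * ww h * ‖x‖ := by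
  rw [d_apply]
  linarith [norm_sub_le (e γ x) (e γ (P γ x)), hx γ hγ,
    norm_e_P_le hB (fun γ _ => hx γ) hγ (p := γ)]

lemma Blocks.d_sum_le {s : ℕ → ℕ} {x : ℕ → X u} (hx : Blocks s x) (γ : ℕ) {B : ℝ} (hB : 0 ≤ B)
    (h : ∀ k, ‖d γ (x k)‖ ≤ B) (S : Finset ℕ) : ‖d γ (∑ k ∈ S, x k)‖ ≤ B := by
  obtain ⟨κ, h1, h2⟩ := exists_exception hx.mono γ
  rw [map_sum]
  refine (norm_sum_le_of_exception (A := 0) hB (κ := κ) (fun k _ hk => ?_) fun _ => ?_).trans ?_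
  · rcases lt_or_gt_of_ne hk with h3 | h3
    · rw [d_eq_zero_of_P_eq (hx.right k) (h1 k h3), norm_zero]
    · rw [d_eq_zero_of_lt (hx.left k) (h2 k h3), norm_zero]
  · rw [zero_add]; exact h κ
  · simp

lemma Blocks.chain_estimate {s : ℕ → ℕ} {x : ℕ → X u} (hx : Blocks s x) {C α β : ℝ} {h : ℕ}
    (hC : ∀ k, ‖x k‖ ≤ C) (hw : ∀ k γ, wt γ = h → ‖e γ (x k)‖ ≤ C * ww h) (hα : 0 ≤ α)
    (hβ : 0 ≤ β)
    (he : ∀ η a b, a ≤ b → ‖e η (∑ k ∈ Ico a b, x k)‖ ≤ α * ((b : ℝ) - a) + β)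
    {γ : ℕ} (hγ : wt γ = h) (a b : ℕ) (hab : a ≤ b) :
    ‖e γ (∑ k ∈ Ico a b, x k)‖ ≤
      ww h * (α * ((b : ℝ) - a) + age γ * β + (9 * age γ + 6) * C) := by
  have hC0 : 0 ≤ C := (norm_nonneg _).trans (hC 0)
  have hW := ww_pos h
  have hd (γ : ℕ) (hγ : wt γ = h) : ‖d γ (∑ k ∈ Ico a b, x k)‖ ≤ ww h * (6 * C) := by
    refine hx.d_sum_le γ (by positivity) (fun k => ?_) _
    have := norm_d_le_of_wt (by positivity) (hw k) hγ
    nlinarith [hC k]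
  induction γ using pred_induction generalizing a b with
  | hroot γ h1 =>
    rw [e_root h1]
    refine (hd γ hγ).trans (mul_le_mul_of_nonneg_left ?_ hW.le)
    have : (a : ℝ) ≤ b := by exact_mod_cast hab
    have h2 : 0 ≤ α * ((b : ℝ) - a) := mul_nonneg hα (by linarith)
    have h3 : 0 ≤ (age γ : ℝ) * β := by positivity
    have h4 : 0 ≤ 9 * (age γ : ℝ) * C := by positivity
    linarith
  | hsucc γ ξ p η h1 ih =>
    obtain ⟨h3, h4, h5, h6, h7, -⟩ := pred_spec h1
    obtain ⟨κ, k1, k2⟩ := exists_exception hx.mono p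
    obtain ⟨c, hac, hcb, hc1, hc2⟩ : ∃ c, a ≤ c ∧ c ≤ b ∧ (∀ k, c ≤ k → k < b → κ < k) ∧
        ∀ k, a ≤ k → k < c → k ≤ κ := by
      refine ⟨min b (max a (κ + 1)), ?_, ?_, ?_, ?_⟩ <;> intros <;> omega
    have hS : ∑ k ∈ Ico a b, x k = ∑ k ∈ Ico a c, x k + ∑ k ∈ Ico c b, x k :=
      (sum_Ico_consecutive _ hac hcb).symm
    have t1 := hd γ hγ
    have hξ : wt ξ = h := h6.symm.trans hγ
    have t2 : e ξ (∑ k ∈ Ico a b, x k) = e ξ (∑ k ∈ Ico a c, x k) := by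
      rw [hS, map_add, map_sum (e ξ) _ (Ico c b), sum_eq_zero (s := Ico c b), add_zero]
      intro k hk
      rw [mem_Ico] at hk
      exact e_eq_zero_of_lt (hx.left k) (h3.trans (k2 k (hc1 k hk.1 hk.2)))
    have t3 := ih ξ (by omega) hξ a c hac (fun γ hγ => by
      refine hx.d_sum_le γ (by positivity) (fun k => ?_) _
      have := norm_d_le_of_wt (by positivity) (hw k) hγ
      nlinarith [hC k])
    have t4 : P p (∑ k ∈ Ico c b, x k) = 0 := by
      rw [map_sum]
      refine sum_eq_zero fun k hk => ?_
      rw [mem_Ico] at hk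
      exact P_eq_zero_of_le (k2 k (hc1 k hk.1 hk.2)).le (hx.left k)
    have t5 : ‖e η (∑ k ∈ Ico a c, x k) - e η (P p (∑ k ∈ Ico a c, x k))‖ ≤ 3 * C := by
      rw [map_sum, map_sum, map_sum, ← sum_sub_distrib]
      refine (norm_sum_le_of_exception (A := 0) (B := 3 * C) (by positivity) (κ := κ)
        (fun k hk hk' => ?_) fun _ => ?_).trans (by simp)
      · rw [mem_Ico] at hk
        have := hc2 k hk.1 hk.2
        rw [P_of_le (k1 k (by omega)) (hx.right k), sub_self, norm_zero]
      · have := norm_sub_le (e η (x κ)) (e η (P p (x κ)))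
        linarith [norm_e_le η (x κ), norm_e_le η (P p (x κ)), norm_P_le p (x κ), hC κ]
    have t6 := he η c b hcb
    have t7 : ‖e η (∑ k ∈ Ico a b, x k) - e η (P p (∑ k ∈ Ico a b, x k))‖ ≤
        3 * C + (α * ((b : ℝ) - c) + β) := by
      rw [hS, map_add (P p), t4, add_zero, map_add, add_sub_right_comm]
      exact (norm_add_le _ _).trans (add_le_add t5 t6)
    rw [e_succ h1, t2, h7, hγ]
    push_cast
    have t8 : ‖ww h • u (e η (∑ k ∈ Ico a b, x k) - e η (P p (∑ k ∈ Ico a b, x k)))‖ ≤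
        ww h * (3 * C + (α * ((b : ℝ) - c) + β)) := by
      rw [norm_smul, Real.norm_of_nonneg hW.le]
      exact mul_le_mul_of_nonneg_left ((norm_u_le hu.out _).trans t7) hW.le
    refine (norm_add₃_le).trans ((add_le_add (add_le_add t1 t3) t8).trans (le_of_eq ?_))
    ring

lemma rec_step {s : ℕ → ℕ} {x : ℕ → X u} (hx : Blocks s x) {C M : ℝ} {j : ℕ}
    (hM : 0 < M) (hC : ∀ k, ‖x k‖ ≤ C)
    (hw : ∀ k γ, wt γ < j → ‖e γ (x k)‖ ≤ C * ww (wt γ)) (L : ℕ)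
    (he : ∀ η a b, a ≤ b → ‖e η (∑ k ∈ Ico a b, x k)‖ ≤
      2 * C * (((b : ℝ) - a) / M + (1 / 2) ^ L * ((b : ℝ) - a) + (qq j : ℝ) ^ L))
    {γ : ℕ} (hγ : wt γ < j) (a b : ℕ) (hab : a ≤ b) :
    ‖e γ (∑ k ∈ Ico a b, x k)‖ ≤ ww (wt γ) *
      (2 * C * (((b : ℝ) - a) / M + (1 / 2) ^ L * ((b : ℝ) - a) + (qq j : ℝ) ^ (L + 1))) := by
  have hC0 : 0 ≤ C := (norm_nonneg _).trans (hC 0)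
  have h := hx.chain_estimate (α := 2 * C * (1 / M + (1 / 2) ^ L)) (β := 2 * C * (qq j : ℝ) ^ L)
    hC (fun k γ' h => (hw k γ' (h ▸ hγ)).trans (by rw [h])) (by positivity) (by positivity)
    (fun η a b hab => (he η a b hab).trans (le_of_eq (by ring))) (γ := γ) rfl a b hab
  refine h.trans (mul_le_mul_of_nonneg_left ?_ (ww_pos _).le)
  have h1 : (9 : ℝ) * age γ ≤ qq j := by
    exact_mod_cast (Nat.mul_le_mul_left 9 (age_le γ)).trans (nine_nn_le_qq hγ)
  have h2 : (36 : ℝ) ≤ qq j := by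
    have := nine_nn_le_qq hγ
    have := (pos_aux (wt γ)).2.2
    exact_mod_cast (by omega : 36 ≤ qq j)
  have h3 : (1 : ℝ) ≤ (qq j : ℝ) ^ L := one_le_pow₀ (by linarith)
  have h4 : (age γ : ℝ) * (qq j : ℝ) ^ L ≤ 1 / 9 * (qq j : ℝ) ^ (L + 1) := by
    rw [pow_succ]; nlinarith
  have h5 : (9 * (age γ : ℝ) + 6) ≤ 7 / 6 * (qq j : ℝ) ^ (L + 1) := by
    rw [pow_succ]; nlinarith
  have h6 : 0 ≤ (qq j : ℝ) ^ (L + 1) := by positivity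
  calc _ = 2 * C * (((b : ℝ) - a) / M + (1 / 2) ^ L * ((b : ℝ) - a)) +
      C * (2 * (age γ * (qq j : ℝ) ^ L) + (9 * age γ + 6)) := by ring
    _ ≤ 2 * C * (((b : ℝ) - a) / M + (1 / 2) ^ L * ((b : ℝ) - a)) +
      C * (2 * (qq j : ℝ) ^ (L + 1)) := by
        gcongr
        linarith
    _ = _ := by ring

lemma rec_estimate {s : ℕ → ℕ} {x : ℕ → X u} (hx : Blocks s x) {C M : ℝ} {j : ℕ}
    (hM : 0 < M) (hC : ∀ k, ‖x k‖ ≤ C)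
    (hw : ∀ k γ, wt γ < j → ‖e γ (x k)‖ ≤ C * ww (wt γ))
    (hj : ∀ γ, j ≤ wt γ → ∀ a b, a ≤ b →
      ‖e γ (∑ k ∈ Ico a b, x k)‖ ≤ C * (1 + ((b : ℝ) - a) / M)) (L : ℕ)
    (γ a b : ℕ) (hab : a ≤ b) : ‖e γ (∑ k ∈ Ico a b, x k)‖ ≤
      2 * C * (((b : ℝ) - a) / M + (1 / 2) ^ L * ((b : ℝ) - a) + (qq j : ℝ) ^ L) := by
  have hC0 : 0 ≤ C := (norm_nonneg _).trans (hC 0)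
  have hq : (1 : ℝ) ≤ qq j := by exact_mod_cast one_le_qq j
  induction L generalizing γ a b with
  | zero =>
    have h1 : ‖e γ (∑ k ∈ Ico a b, x k)‖ ≤ ((b : ℝ) - a) * C := by
      rw [map_sum]
      refine (norm_sum_le_of_le _ fun k _ => (norm_e_le γ _).trans (hC k)).trans (le_of_eq ?_)
      rw [sum_const, Nat.card_Ico, nsmul_eq_mul, Nat.cast_sub hab]
    have h2 : (0 : ℝ) ≤ (b : ℝ) - a := by simpa using hab
    have h3 : 0 ≤ ((b : ℝ) - a) / M := by positivity
    simp only [pow_zero]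
    nlinarith [mul_nonneg hC0 h3, mul_nonneg hC0 h2]
  | succ L ih =>
    have h2 : (0 : ℝ) ≤ (b : ℝ) - a := by simpa using hab
    have h3 : 0 ≤ ((b : ℝ) - a) / M := by positivity
    have h4 : (1 : ℝ) ≤ (qq j : ℝ) ^ (L + 1) := one_le_pow₀ hq
    have h5 : 0 ≤ (1 / 2 : ℝ) ^ L * ((b : ℝ) - a) := by positivity
    rcases lt_or_ge (wt γ) j with hγ | hγ
    · refine (rec_step hx hM hC hw L ih hγ a b hab).trans ?_
      have h6 := ww_le (wt γ)
      have h7 := ww_pos (wt γ)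
      rw [pow_succ (1 / 2 : ℝ)]
      calc _ ≤ 1 / 4 * (2 * C * (((b : ℝ) - a) / M + (1 / 2) ^ L * ((b : ℝ) - a) +
              (qq j : ℝ) ^ (L + 1))) := by gcongr
        _ ≤ _ := by nlinarith [mul_nonneg hC0 h3, mul_nonneg hC0 h5,
              mul_nonneg hC0 (zero_le_one.trans h4)]
    · refine (hj γ hγ a b hab).trans ?_
      have h6 : 0 ≤ (1 / 2 : ℝ) ^ (L + 1) * ((b : ℝ) - a) := by positivity
      nlinarith [mul_nonneg hC0 h3, mul_nonneg hC0 h6, mul_le_mul_of_nonneg_left h4 hC0]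

lemma length_estimate {j : ℕ} {M : ℝ} (hM : 0 < M) (hMj : M ≤ (mm j : ℝ) ^ 2) {i : ℕ}
    (hi : i ≤ mm j ^ 2 + 1) :
    (nn j : ℝ) / M + (1 / 2) ^ (mm j ^ 2) * (nn j : ℝ) + (qq j : ℝ) ^ i ≤
      3 * (nn j / M) := by
  have hn := nnr_pos j
  have hm := mm_pos j
  have hq : (1 : ℝ) ≤ qq j := by exact_mod_cast one_le_qq j
  have h1 : (1 / 2 : ℝ) ^ (mm j ^ 2) * (nn j : ℝ) ≤ nn j / M := by
    rw [div_eq_mul_inv (nn j : ℝ), mul_comm]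
    refine mul_le_mul_of_nonneg_left ?_ hn.le
    rw [one_div, inv_pow]
    refine inv_anti₀ hM (hMj.trans ?_)
    exact_mod_cast (Nat.lt_two_pow_self (n := mm j ^ 2)).le
  have h2 : (qq j : ℝ) ^ i ≤ nn j / M := by
    rw [le_div_iff₀ hM]
    calc (qq j : ℝ) ^ i * M ≤ (qq j : ℝ) ^ (mm j ^ 2 + 1) * (mm j : ℝ) ^ 2 := by
          gcongr
      _ ≤ nn j := by
          have := sq_mm_mul_le_nn j
          rw [mul_comm]
          exact_mod_cast this
  linarith

lemma rec_final {s : ℕ → ℕ} {x : ℕ → X u} (hx : Blocks s x) {C M : ℝ} {j : ℕ}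
    (hM : 0 < M) (hMj : M ≤ (mm j : ℝ) ^ 2) (hC : ∀ k, ‖x k‖ ≤ C)
    (hw : ∀ k γ, wt γ < j → ‖e γ (x k)‖ ≤ C * ww (wt γ))
    (hj : ∀ γ, j ≤ wt γ → ∀ a b, a ≤ b →
      ‖e γ (∑ k ∈ Ico a b, x k)‖ ≤ C * (1 + ((b : ℝ) - a) / M)) (γ : ℕ) :
    ‖e γ (∑ k ∈ range (nn j), x k)‖ ≤ 6 * C * (nn j / M) ∧
    (wt γ < j → ‖e γ (∑ k ∈ range (nn j), x k)‖ ≤ ww (wt γ) * (6 * C * (nn j / M))) := by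
  have hC0 : 0 ≤ C := (norm_nonneg _).trans (hC 0)
  have key := rec_estimate hx hM hC hw hj (mm j ^ 2)
  rw [range_eq_Ico]
  constructor
  · have h := key γ 0 (nn j) (Nat.zero_le _)
    rw [Nat.cast_zero, sub_zero] at h
    have := length_estimate hM hMj (Nat.le_succ _)
    nlinarith
  · intro hγ
    have h := rec_step hx hM hC hw _ key hγ 0 (nn j) (Nat.zero_le _)
    rw [Nat.cast_zero, sub_zero] at h
    refine h.trans (mul_le_mul_of_nonneg_left ?_ (ww_pos _).le)
    have := length_estimate hM hMj (le_refl (mm j ^ 2 + 1))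
    nlinarith

/-- Vectors which are small on weights below `j`. -/
def RV (C : ℝ) (j : ℕ) (x : X u) : Prop :=
  ‖x‖ ≤ C ∧ ∀ γ, wt γ < j → ‖e γ x‖ ≤ C * ww (wt γ)

lemma RV.anti {C : ℝ} {i j : ℕ} (h : i ≤ j) {x : X u} (hx : RV C j x) : RV C i x :=
  ⟨hx.1, fun γ hγ => hx.2 γ (hγ.trans_le h)⟩

lemma RV.mono {C C' : ℝ} {j : ℕ} (h : C ≤ C') {x : X u} (hx : RV C j x) : RV C' j x :=
  ⟨hx.1.trans h, fun γ hγ =>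
    (hx.2 γ hγ).trans (mul_le_mul_of_nonneg_right h (ww_pos _).le)⟩

lemma Blocks.high_estimate {s : ℕ → ℕ} {x : ℕ → X u} (hx : Blocks s x) {C : ℝ}
    (hr : ∀ k, RV C (s k) (x k)) (γ : ℕ) (S : Finset ℕ) :
    ‖e γ (∑ k ∈ S, x k)‖ ≤ C * ww (wt γ) * #S + C := by
  have hC0 : 0 ≤ C := (norm_nonneg _).trans (hr 0).1
  have hW := ww_pos (wt γ)
  obtain ⟨κ, k1, k2⟩ := exists_exception hx.mono (wt γ)
  rw [map_sum]
  refine norm_sum_le_of_exception hC0 (κ := κ) (fun k _ hk => ?_) fun _ => ?_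
  · rcases lt_or_gt_of_ne hk with h | h
    · rw [e_eq_zero_of_le_wt (hx.right k) (k1 k h), norm_zero]; positivity
    · exact (hr k).2 γ (k2 k h)
  · have := (norm_e_le γ _).trans (hr κ).1
    have : 0 ≤ C * ww (wt γ) := by positivity
    linarith

/-- Averages of weight `c`. -/
structure ExactV (C : ℝ) (c : ℕ) (z : X u) : Prop where
  norm_le : ‖z‖ ≤ 6 * C
  low : ∀ γ, wt γ < c → ‖e γ z‖ ≤ 6 * C * ww (wt γ)
  high : ∀ γ, c < wt γ → ‖e γ z‖ ≤ 2 * C * ww c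
  d_le : ∀ γ, ‖d γ z‖ ≤ 3 * C * ww c

lemma ratio_le (c : ℕ) : (mm c : ℝ) / nn c ≤ ww c := by
  rw [div_le_iff₀ (nnr_pos c), ww, inv_mul_eq_div, le_div_iff₀ (mm_pos c), ← sq]
  exact_mod_cast sq_mm_le_nn c

lemma Blocks.rv_sum {s : ℕ → ℕ} {x : ℕ → X u} (hx : Blocks s x) {C : ℝ} {c : ℕ}
    (hr : ∀ k, RV C (s k) (x k)) (hc : c ≤ s 0) (γ : ℕ) :
    ‖e γ (∑ k ∈ range (nn c), x k)‖ ≤ 6 * C * (nn c / mm c) ∧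
    (wt γ < c → ‖e γ (∑ k ∈ range (nn c), x k)‖ ≤ ww (wt γ) * (6 * C * (nn c / mm c))) := by
  have hC0 : 0 ≤ C := (norm_nonneg _).trans (hr 0).1
  have h4 : (1 : ℝ) ≤ mm c := by
    exact_mod_cast (four_le_mm c).trans' (by norm_num)
  refine rec_final hx (mm_pos c) (by nlinarith) (fun k => (hr k).1) (fun k γ hγ => (hr k).2 γ
    (hγ.trans_le (hc.trans (hx.mono.monotone (Nat.zero_le k))))) (fun γ hγ a b hab => ?_) γ
  refine (hx.high_estimate hr γ _).trans ?_
  rw [Nat.card_Ico, Nat.cast_sub hab]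
  have h2 : (0 : ℝ) ≤ (b : ℝ) - a := by simpa using hab
  have h3 : C * ww (wt γ) * ((b : ℝ) - a) ≤ C * ww c * ((b : ℝ) - a) := by
    gcongr; exact ww_anti hγ
  rw [div_eq_inv_mul]
  change _ ≤ C * (1 + ww c * _)
  linarith

lemma Blocks.exactV {s : ℕ → ℕ} {x : ℕ → X u} (hx : Blocks s x) {C : ℝ} {c : ℕ}
    (hr : ∀ k, RV C (s k) (x k)) (hc : c ≤ s 0) :
    ExactV C c (((mm c : ℝ) / nn c) • ∑ k ∈ range (nn c), x k) := by
  have hC0 : 0 ≤ C := (norm_nonneg _).trans (hr 0).1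
  have hm := mm_pos c
  have hn := nnr_pos c
  have hr0 : 0 ≤ (mm c : ℝ) / nn c := by positivity
  have key := hx.rv_sum hr hc
  have e1 (γ : ℕ) : ‖e γ (((mm c : ℝ) / nn c) • ∑ k ∈ range (nn c), x k)‖ =
      (mm c : ℝ) / nn c * ‖e γ (∑ k ∈ range (nn c), x k)‖ := by
    rw [map_smul, norm_smul, Real.norm_of_nonneg hr0]
  refine ⟨norm_le_of (by positivity) fun γ => ?_, fun γ hγ => ?_, fun γ hγ => ?_, fun γ => ?_⟩
  · rw [e1]
    refine (mul_le_mul_of_nonneg_left (key γ).1 hr0).trans (le_of_eq ?_)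
    field_simp
  · rw [e1]
    refine (mul_le_mul_of_nonneg_left ((key γ).2 hγ) hr0).trans (le_of_eq ?_)
    field_simp
  · rw [e1]
    refine (mul_le_mul_of_nonneg_left (hx.high_estimate hr γ _) hr0).trans ?_
    have h1 : (mm c : ℝ) * ww (wt γ) ≤ ww c := by
      have : (mm c : ℝ) ^ 2 ≤ mm (wt γ) := by exact_mod_cast sq_mm_le_mm hγ
      rw [ww, ww, ← div_eq_mul_inv, div_le_iff₀ (mm_pos _), inv_mul_eq_div, le_div_iff₀ hm, ← sq]
      exact this
    have h2 := ratio_le c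
    have h3 : (mm c : ℝ) / nn c * (C * ww (wt γ) * #(range (nn c)) + C) =
        C * (mm c * ww (wt γ)) + C * (mm c / nn c) := by
      rw [card_range]; field_simp
    rw [h3]
    nlinarith [mul_le_mul_of_nonneg_left h1 hC0, mul_le_mul_of_nonneg_left h2 hC0]
  · rw [map_smul, norm_smul, Real.norm_of_nonneg hr0]
    have h1 := hx.d_sum_le γ (B := 3 * C) (by positivity)
      (fun k => (norm_d_le γ _).trans (by linarith [(hr k).1])) (range (nn c))
    calc _ ≤ ww c * (3 * C) := mul_le_mul (ratio_le c) h1 (norm_nonneg _) (ww_pos c).le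
      _ = _ := by ring

end Estimates

lemma exists_seq_of_step {α : Type*} {I : ℕ → α → Prop} {R : ℕ → α → α → Prop} {a₀ : α}
    (h0 : I 0 a₀) (h : ∀ i a, I i a → ∃ a', I (i + 1) a' ∧ R i a a') :
    ∃ f : ℕ → α, f 0 = a₀ ∧ ∀ i, I i (f i) ∧ R i (f i) (f (i + 1)) := by
  choose F hF using h
  let g : ∀ i, {a // I i a} := fun i =>
    Nat.rec ⟨a₀, h0⟩ (fun i a => ⟨F i a.1 a.2, (hF i a.1 a.2).1⟩) i
  exact ⟨fun i => (g i).1, rfl, fun i => ⟨(g i).2, (hF i (g i).1 (g i).2).2⟩⟩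

section Operators

variable {V : Type} [NormedAddCommGroup V] [NormedSpace ℝ V] {u : V →L[ℝ] V}
  [hu : Fact (‖u‖ ≤ 1)]

/-- Vectors of finite support. -/
def FS (x : X u) : Prop := ∃ t, P t x = x

lemma FS.exists_ge {x : X u} (hx : FS x) (B : ℕ) : ∃ t, B ≤ t ∧ P t x = x := by
  obtain ⟨t, ht⟩ := hx
  exact ⟨max B t, le_max_left _ _, P_of_le (le_max_right _ _) ht⟩

lemma exists_blocks {Q : ℕ → X u → Prop} (h : ∀ q, ∃ x, Q q x ∧ FS x ∧ P q x = 0) (q₀ : ℕ) :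
    ∃ s x, Blocks s x ∧ s 0 = q₀ ∧ ∀ k, Q (s k) (x k) := by
  choose f h1 h2 h3 using h
  choose t ht using fun q => (h2 q).exists_ge (q + 1)
  let s : ℕ → ℕ := fun k => Nat.rec q₀ (fun _ q => t q) k
  exact ⟨s, fun k => f (s k), ⟨strictMono_nat_of_lt_succ fun k => (ht (s k)).1,
    fun k => h3 _, fun k => (ht (s k)).2⟩, rfl, fun k => h1 _⟩

lemma norm_P_le_of {p : ℕ} {x : X u} {B : ℝ} (hB : 0 ≤ B) (h : ∀ γ < p, ‖e γ x‖ ≤ B) :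
    ‖P p x‖ ≤ 2 * B :=
  norm_le_of (by positivity) fun γ => Rv_norm_le hB h γ

lemma exists_small_functional [FiniteDimensional ℝ V] (g : X u →L[ℝ] V) (C : ℝ) {ε : ℝ}
    (hε : 0 < ε) :
    ∃ q, ∀ x, FS x → P q x = 0 → RV C q x → ‖g x‖ < ε := by
  have : ProperSpace V := FiniteDimensional.proper ℝ V
  by_contra! hcon
  choose x h1 h2 h3 h4 using hcon
  have hC0 : 0 ≤ C := (norm_nonneg _).trans (h3 0).1
  obtain ⟨v, -, φ, hφ, hv⟩ := tendsto_subseq_of_bounded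
    (Metric.isBounded_closedBall (x := (0 : V)) (r := ‖g‖ * C)) (x := fun q => g (x q)) fun q => by
      rw [mem_closedBall_zero_iff]
      exact (g.le_opNorm _).trans (mul_le_mul_of_nonneg_left (h3 q).1 (norm_nonneg _))
  have hv1 : ε ≤ ‖v‖ := ge_of_tendsto hv.norm (Eventually.of_forall fun q => h4 _)
  have hex : ∀ q, ∃ x, (RV C q x ∧ ‖g x - v‖ < ε / 2) ∧ FS x ∧ P q x = 0 := by
    intro q
    obtain ⟨N, hN⟩ := Metric.tendsto_atTop.1 hv (ε / 2) (by positivity)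
    have hq : q ≤ φ (max N q) := (le_max_right _ _).trans hφ.le_apply
    have := hN (max N q) (le_max_left _ _)
    rw [dist_eq_norm] at this
    exact ⟨x (φ (max N q)), ⟨(h3 _).anti hq, this⟩, h1 _, P_eq_zero_of_le hq (h2 _)⟩
  obtain ⟨j, hj⟩ := exists_nat_gt (‖g‖ * (6 * C) / (ε / 2))
  obtain ⟨s, y, hb, hs, hQ⟩ := exists_blocks hex j
  have e1 : ‖∑ k ∈ range (nn j), y k‖ ≤ 6 * C * (nn j / mm j) := by
    have hm := mm_pos j
    exact norm_le_of (by positivity) fun γ => (hb.rv_sum (fun k => (hQ k).1) hs.ge γ).1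
  have e2 : ‖g (∑ k ∈ range (nn j), y k) - (nn j : ℝ) • v‖ ≤ nn j * (ε / 2) := by
    have : g (∑ k ∈ range (nn j), y k) - (nn j : ℝ) • v =
        ∑ k ∈ range (nn j), (g (y k) - v) := by
      rw [map_sum, sum_sub_distrib, sum_const, card_range, Nat.cast_smul_eq_nsmul]
    rw [this]
    refine (norm_sum_le_of_le _ fun k _ => (hQ k).2.le).trans ?_
    rw [sum_const, card_range, nsmul_eq_mul]
  have e3 : (nn j : ℝ) * ε ≤ ‖(nn j : ℝ) • v‖ := by
    rw [norm_smul, Real.norm_of_nonneg (nnr_pos j).le]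
    exact mul_le_mul_of_nonneg_left hv1 (nnr_pos j).le
  have e4 := norm_sub_norm_le ((nn j : ℝ) • v) (g (∑ k ∈ range (nn j), y k))
  rw [norm_sub_rev] at e4
  have e5 := (g.le_opNorm (∑ k ∈ range (nn j), y k)).trans
    (mul_le_mul_of_nonneg_left e1 (norm_nonneg _))
  have e6 : (nn j : ℝ) * (ε / 2) ≤ ‖g‖ * (6 * C * (nn j / mm j)) := by linarith
  have e7 : (mm j : ℝ) * (ε / 2) ≤ ‖g‖ * (6 * C) := by
    have hn := nnr_pos j
    have hm := mm_pos j
    have : ‖g‖ * (6 * C * (nn j / mm j)) = nn j * (‖g‖ * (6 * C) / mm j) := by ring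
    rw [this, mul_le_mul_iff_right₀ hn, le_div_iff₀ hm] at e6
    linarith
  have e8 : (j : ℝ) ≤ mm j := by exact_mod_cast mm_strictMono.le_apply
  rw [div_lt_iff₀ (by positivity)] at hj
  nlinarith

lemma exists_small_P [FiniteDimensional ℝ V] (T : X u →L[ℝ] X u) (C : ℝ) (p : ℕ) {ε : ℝ}
    (hε : 0 < ε) :
    ∃ q, ∀ x, FS x → P q x = 0 → RV C q x → ‖P p (T x)‖ < ε := by
  choose q hq using fun γ => exists_small_functional ((e γ).comp T) C (show 0 < ε / 4 by positivity)
  refine ⟨(range p).sup q, fun x h1 h2 h3 => ?_⟩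
  have : ‖P p (T x)‖ ≤ 2 * (ε / 4) := norm_P_le_of (by positivity) fun γ hγ => by
    have hle := le_sup (f := q) (mem_range.2 hγ)
    exact (hq γ x h1 (P_eq_zero_of_le hle h2) (h3.anti hle)).le
  linarith

/-- A chain of indices of weight `j` together with blocks, adapted to the operator `T`. -/
structure Chain (T : X u →L[ℝ] X u) (j p₀ : ℕ) (δ : ℝ) (ξ p η : ℕ → ℕ) (x : ℕ → X u) : Prop where
  blocks : Blocks p x
  le_p : p₀ ≤ p 0
  lt : ∀ i, ξ i < p i
  wt_eq : ∀ i, wt (ξ i) = j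
  zero : ∀ i, nn j ≤ i → x i = 0
  pred_eq : ∀ i < nn j, pred (ξ (i + 1)) = some (ξ i, p i, η i)
  d_zero : ∀ i < nn j, d (ξ (i + 1)) (x i) = 0
  small : ∀ i < nn j, ‖P (p i) (T (x i))‖ ≤ δ
  est : ‖e (ξ (nn j)) (T (∑ i ∈ range (nn j), x i)) -
    ww j • u (∑ i ∈ range (nn j), e (η i) (T (x i)))‖ ≤ nn j * (4 * δ)

lemma chain_step {T : X u →L[ℝ] X u} {δ : ℝ} {ξ p η ξ' : ℕ} {Y x : X u} (hξp : ξ < p)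
    (hpred : pred ξ' = some (ξ, p, η)) (hY : ‖T Y - P p (T Y)‖ ≤ δ) (hx : ‖P p (T x)‖ ≤ δ)
    (hd : ‖d ξ' (T (Y + x))‖ ≤ δ) :
    ‖e ξ' (T (Y + x)) - (e ξ (T Y) + ww (wt ξ') • u (e η (T x)))‖ ≤ 4 * δ := by
  have e1 : ‖e ξ (T x)‖ ≤ δ := by
    rw [← e_P_lt hξp]; exact (norm_e_le _ _).trans hx
  have e2 : ‖e η (T Y - P p (T Y)) - e η (P p (T x))‖ ≤ 2 * δ := by
    linarith [norm_sub_le (e η (T Y - P p (T Y))) (e η (P p (T x))),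
      norm_e_le η (T Y - P p (T Y)), norm_e_le η (P p (T x))]
  have e3 : ‖ww (wt ξ') • u (e η (T Y - P p (T Y)) - e η (P p (T x)))‖ ≤ 1 / 4 * (2 * δ) := by
    rw [norm_smul, Real.norm_of_nonneg (ww_pos _).le]
    exact mul_le_mul (ww_le _) ((norm_u_le hu.out _).trans e2) (norm_nonneg _) (by norm_num)
  have e4 : e ξ' (T (Y + x)) - (e ξ (T Y) + ww (wt ξ') • u (e η (T x))) =
      d ξ' (T (Y + x)) + e ξ (T x) + ww (wt ξ') • u (e η (T Y - P p (T Y)) - e η (P p (T x))) := by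
    rw [e_succ hpred]
    simp only [map_add, map_sub, smul_add, smul_sub]
    abel
  rw [e4]
  have := norm_add₃_le (a := d ξ' (T (Y + x))) (b := e ξ (T x))
    (c := ww (wt ξ') • u (e η (T Y - P p (T Y)) - e η (P p (T x))))
  linarith [norm_nonneg (e ξ (T x))]

lemma exists_chain (T : X u →L[ℝ] X u) (j p₀ : ℕ) {δ : ℝ} (hδ : 0 < δ)
    {Q : ℕ → ℕ → ℕ → X u → ℕ → Prop}
    (hsup : ∀ i ξ p, wt ξ = j → ξ < p → ∃ x η, Q i ξ p x η ∧ FS x ∧ P p x = 0 ∧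
      ‖P p (T x)‖ ≤ δ ∧ (Odd j → wt η = 2 * ξ + 2)) :
    ∃ ξ p η x, Chain T j p₀ δ ξ p η x ∧ ∀ i < nn j, Q i (ξ i) (p i) (x i) (η i) := by
  let I : ℕ → ℕ × ℕ × X u × X u × ℕ → Prop := fun i a =>
    wt a.1 = j ∧ (i ≤ nn j → age a.1 = i) ∧ a.1 < a.2.1 ∧ P a.2.1 a.2.2.1 = a.2.2.1 ∧
      ‖T a.2.2.1 - P a.2.1 (T a.2.2.1)‖ ≤ δ
  let R : ℕ → ℕ × ℕ × X u × X u × ℕ → ℕ × ℕ × X u × X u × ℕ → Prop := fun i a a' =>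
    a.2.1 < a'.2.1 ∧ a'.2.2.1 = a.2.2.1 + a'.2.2.2.1 ∧ P a.2.1 a'.2.2.2.1 = 0 ∧
      P a'.2.1 a'.2.2.2.1 = a'.2.2.2.1 ∧ (nn j ≤ i → a'.2.2.2.1 = 0) ∧
      (i < nn j → Q i a.1 a.2.1 a'.2.2.2.1 a'.2.2.2.2 ∧
        pred a'.1 = some (a.1, a.2.1, a'.2.2.2.2) ∧ d a'.1 a'.2.2.2.1 = 0 ∧
        ‖P a.2.1 (T a'.2.2.2.1)‖ ≤ δ ∧ ‖d a'.1 (T a'.2.2.1)‖ ≤ δ)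
  have hP (Y : X u) (B : ℕ) : ∃ p, B ≤ p ∧ ‖T Y - P p (T Y)‖ ≤ δ := by
    obtain ⟨N, hN⟩ := Metric.tendsto_atTop.1 (tendsto_P (T Y)) δ hδ
    have := hN (max N B) (le_max_left _ _)
    rw [dist_comm, dist_eq_norm] at this
    exact ⟨max N B, le_max_right _ _, this.le⟩
  obtain ⟨ξ₀, -, hξ₀, hage₀, -⟩ := exists_root j 0
  have h0 : I 0 (ξ₀, max p₀ (ξ₀ + 1), 0, 0, 0) :=
    ⟨hξ₀, fun _ => hage₀, by simp, map_zero _, by simpa using hδ.le⟩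
  have hstep : ∀ i a, I i a → ∃ a', I (i + 1) a' ∧ R i a a' := by
    rintro i ⟨ξ, p, Y, x₀, η₀⟩ ⟨i1, i2, i3, i4, i5⟩
    dsimp only at i1 i2 i3 i4 i5
    rcases lt_or_ge i (nn j) with hi | hi
    · obtain ⟨x, η, q1, q2, q3, q4, q5⟩ := hsup i ξ p i1 i3
      obtain ⟨t, ht1, ht2⟩ := q2.exists_ge p
      obtain ⟨N, hN⟩ := Metric.tendsto_atTop.1 (tendsto_d (T (Y + x))) δ hδ
      obtain ⟨ξ', k1, k2⟩ := exists_succ (η := η) i3 (by rw [i1, i2 hi.le]; omega)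
        (by rw [i1]; exact q5) (max N t)
      have k3 := hN ξ' ((le_max_left _ _).trans k1)
      rw [dist_zero_right] at k3
      have k4 : t ≤ ξ' := (le_max_right _ _).trans k1
      obtain ⟨p', r1, r2⟩ := hP (Y + x) (ξ' + 1)
      obtain ⟨s1, s2, s3, s4, s5, s6, s7⟩ := pred_spec k2
      refine ⟨(ξ', p', Y + x, x, η), ⟨s4.trans i1, fun _ => ?_, r1, ?_, r2⟩,
        by show p < p'; omega, rfl, q3, P_of_le (show t ≤ p' by omega) ht2,
        fun h => absurd h hi.not_ge,
        fun _ => ⟨q1, k2, d_eq_zero_of_P_eq ht2 k4, q4, k3.le⟩⟩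
      · show age ξ' = i + 1
        rw [s5, i2 hi.le]
      · show P p' (Y + x) = Y + x
        rw [map_add, P_of_le (by omega) i4, P_of_le (by omega) ht2]
    · obtain ⟨p', r1, r2⟩ := hP Y (p + 1)
      exact ⟨(ξ, p', Y, 0, 0), ⟨i1, fun h => by omega, by show ξ < p'; omega,
        P_of_le (show p ≤ p' by omega) i4, r2⟩, r1, (add_zero Y).symm, map_zero _, map_zero _,
        fun _ => rfl,
        fun h => by omega⟩
  obtain ⟨f, f0, hf⟩ := exists_seq_of_step h0 hstep
  have hI := fun i => (hf i).1
  have hR := fun i => (hf i).2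
  refine ⟨fun i => (f i).1, fun i => (f i).2.1, fun i => (f (i + 1)).2.2.2.2,
    fun i => (f (i + 1)).2.2.2.1, ⟨⟨strictMono_nat_of_lt_succ fun i => (hR i).1,
      fun i => (hR i).2.2.1, fun i => (hR i).2.2.2.1⟩, ?_, fun i => (hI i).2.2.1,
      fun i => (hI i).1, fun i => (hR i).2.2.2.2.1,
      fun i hi => ((hR i).2.2.2.2.2 hi).2.1, fun i hi => ((hR i).2.2.2.2.2 hi).2.2.1,
      fun i hi => ((hR i).2.2.2.2.2 hi).2.2.2.1, ?_⟩, fun i hi => ((hR i).2.2.2.2.2 hi).1⟩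
  · show p₀ ≤ (f 0).2.1
    rw [f0]; exact le_max_left _ _
  · have hY : ∀ i, (f i).2.2.1 = ∑ k ∈ range i, (f (k + 1)).2.2.2.1 := by
      intro i
      induction i with
      | zero => rw [f0]; rfl
      | succ i ih => rw [sum_range_succ, ← ih]; exact (hR i).2.1
    have key : ∀ i ≤ nn j, ‖e (f i).1 (T (f i).2.2.1) -
        ww j • u (∑ k ∈ range i, e (f (k + 1)).2.2.2.2 (T (f (k + 1)).2.2.2.1))‖ ≤
        i * (4 * δ) := by
      intro i
      induction i with
      | zero => intro _; rw [f0]; simp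
      | succ i ih =>
        intro hi
        have h1 := ih (by omega)
        obtain ⟨-, a1, a2, a3, -, a4⟩ := hR i
        obtain ⟨-, b1, b2, b3, b4⟩ := a4 (by omega)
        rw [a1] at b4
        have h2 := chain_step (hI i).2.2.1 b1 (hI i).2.2.2.2 b3 b4
        rw [(hI (i + 1)).1] at h2
        rw [sum_range_succ, a1, map_add u, smul_add]
        have h3 := norm_add_le_of_le h2 h1
        refine (le_of_eq ?_).trans (h3.trans (le_of_eq ?_))
        · congr 1; abel
        · push_cast; ring
    have := key _ le_rfl
    rw [hY] at this
    exact this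

lemma Chain.e_index {T : X u →L[ℝ] X u} {j p₀ : ℕ} {δ : ℝ} {ξ p η : ℕ → ℕ} {x : ℕ → X u}
    (h : Chain T j p₀ δ ξ p η x) {s : ℕ} (hs : s ≤ nn j) (k : ℕ) :
    e (ξ s) (x k) = if k < s then ww j • u (e (η k) (x k)) else 0 := by
  have h0 (s k : ℕ) (hk : s ≤ k) : e (ξ s) (x k) = 0 :=
    e_eq_zero_of_lt (h.blocks.left k) ((h.lt s).trans_le (h.blocks.mono.monotone hk))
  induction s with
  | zero => simp [h0 0 k (Nat.zero_le k)]
  | succ s ih =>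
    have hp := h.pred_eq s hs
    obtain ⟨-, s2, -⟩ := pred_spec hp
    rcases lt_trichotomy k s with hk | rfl | hk
    · have h1 : P (p s) (x k) = x k := P_of_le (h.blocks.mono.monotone hk) (h.blocks.right k)
      rw [e_succ hp, ih (by omega), d_eq_zero_of_P_eq h1 s2.le, h1, if_pos hk, if_pos (by omega)]
      simp
    · rw [e_succ hp, h.d_zero k hs, h0 k k le_rfl, h.blocks.left k, h.wt_eq, if_pos (by omega)]
      simp
    · rw [h0 _ _ hk, if_neg (by omega)]

end Operators

lemma abs_sum_neg_one_pow_le (a b : ℕ) : |∑ k ∈ Ico a b, (-1 : ℝ) ^ k| ≤ 1 := by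
  rcases le_total a b with h | h
  · rw [sum_Ico_eq_sub _ h, neg_one_geom_sum, neg_one_geom_sum]
    split_ifs <;> norm_num
  · simp [Ico_eq_empty_of_le h]

lemma sum_alternating {E : Type*} [AddCommGroup E] [Module ℝ E] (v w : E) (m : ℕ) :
    ∑ k ∈ range (2 * m), (-1 : ℝ) ^ k • (if Even k then v else w) = (m : ℝ) • (v - w) := by
  induction m with
  | zero => simp
  | succ m ih =>
    rw [show 2 * (m + 1) = 2 * m + 1 + 1 by ring, sum_range_succ, sum_range_succ, ih,
      if_pos (even_two_mul m), if_neg (by simp), Even.neg_one_pow (even_two_mul m),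
      Odd.neg_one_pow (odd_two_mul_add_one m)]
    push_cast
    module

section Uniqueness

variable {V : Type} [NormedAddCommGroup V] [NormedSpace ℝ V] {u : V →L[ℝ] V}
  [hu : Fact (‖u‖ ≤ 1)]

/-- The pair `(a, v)` is asymptotically realised by vectors and their images. -/
def Cluster (T : X u →L[ℝ] X u) (C : ℝ) (a v : V) : Prop :=
  ∀ (p : ℕ) (ε : ℝ), 0 < ε → ∃ x η, FS x ∧ P p x = 0 ∧ RV C p x ∧ ‖e η x - a‖ < ε ∧
    ‖e η (T x) - v‖ < ε

lemma Cluster.mono {T : X u →L[ℝ] X u} {C C' : ℝ} (h : C ≤ C') {a v : V} (hc : Cluster T C a v) :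
    Cluster T C' a v := fun p ε hε => by
  obtain ⟨x, η, h1, h2, h3, h4⟩ := hc p ε hε
  exact ⟨x, η, h1, h2, h3.mono h, h4⟩

lemma Cluster.exists_small_P [FiniteDimensional ℝ V] {T : X u →L[ℝ] X u} {C : ℝ} {a v : V}
    (h : Cluster T C a v) (p : ℕ) {ε : ℝ} (hε : 0 < ε) :
    ∃ x η, FS x ∧ P p x = 0 ∧ RV C p x ∧ ‖e η x - a‖ < ε ∧ ‖e η (T x) - v‖ < ε ∧
      ‖P p (T x)‖ < ε := by
  obtain ⟨q, hq⟩ := Calkin.exists_small_P T C p hε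
  obtain ⟨x, η, h1, h2, h3, h4, h5⟩ := h (max p q) ε hε
  exact ⟨x, η, h1, P_eq_zero_of_le (le_max_left _ _) h2, h3.anti (le_max_left _ _), h4, h5,
    hq x h1 (P_eq_zero_of_le (le_max_right _ _) h2) (h3.anti (le_max_right _ _))⟩

lemma norm_scaled_sub_le {c n : ℕ} (hn : n = nn c) {f : ℕ → V} {a y : V} {δ δ' : ℝ}
    (hf : ∀ i < n, ‖f i - a‖ ≤ δ) (hy : ‖y - ww c • u (∑ i ∈ range n, f i)‖ ≤ n * δ') :
    ‖((mm c : ℝ) / n) • y - u a‖ ≤ mm c * δ' + δ := by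
  have hm := mm_pos c
  have hn0 : (0 : ℝ) < n := hn ▸ nnr_pos c
  have h1 : ‖∑ i ∈ range n, (f i - a)‖ ≤ n * δ := by
    refine (norm_sum_le_of_le _ fun i hi => hf i (mem_range.1 hi)).trans ?_
    rw [sum_const, card_range, nsmul_eq_mul]
  have h2 : ((mm c : ℝ) / n) • y - u a =
      ((mm c : ℝ) / n) • (y - ww c • u (∑ i ∈ range n, f i)) +
        (1 / n : ℝ) • u (∑ i ∈ range n, (f i - a)) := by
    rw [sum_sub_distrib, sum_const, card_range, map_sub, ← Nat.cast_smul_eq_nsmul ℝ n, map_smul,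
      smul_sub, smul_sub, smul_smul, smul_smul, one_div, inv_mul_cancel₀ hn0.ne', one_smul]
    have : (mm c : ℝ) / n * ww c = (n : ℝ)⁻¹ := by
      rw [ww]; field_simp
    rw [this]; abel
  rw [h2]
  refine (norm_add_le _ _).trans (add_le_add ?_ ?_)
  · rw [norm_smul, Real.norm_of_nonneg (by positivity)]
    refine (mul_le_mul_of_nonneg_left hy (by positivity)).trans (le_of_eq ?_)
    field_simp
  · rw [norm_smul, Real.norm_of_nonneg (by positivity)]
    refine (mul_le_mul_of_nonneg_left ((norm_u_le hu.out _).trans h1)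
      (by positivity)).trans (le_of_eq ?_)
    field_simp

lemma Cluster.exists_exact [FiniteDimensional ℝ V] {T : X u →L[ℝ] X u} {C : ℝ} {a v : V}
    (h : Cluster T C a v) {c : ℕ} (hc : Even c) (p : ℕ) {ε : ℝ} (hε : 0 < ε) :
    ∃ z ζ, FS z ∧ P p z = 0 ∧ wt ζ = c ∧ ExactV C c z ∧ ‖e ζ z - u a‖ < ε ∧
      ‖e ζ (T z) - u v‖ < ε ∧ ‖P p (T z)‖ < ε := by
  have hm := mm_pos c
  have hn := nnr_pos c
  have hm4 : (4 : ℝ) ≤ mm c := by exact_mod_cast four_le_mm c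
  obtain ⟨δ, hδ, hδε⟩ : ∃ δ : ℝ, 0 < δ ∧ mm c * (8 * δ) ≤ ε :=
    ⟨ε / (8 * mm c), by positivity, le_of_eq (by field_simp)⟩
  obtain ⟨ξ, q, η, x, hch, hQ⟩ := exists_chain T c (max p c) hδ
    (Q := fun _ _ q x η => RV C q x ∧ ‖e η x - a‖ < δ ∧ ‖e η (T x) - v‖ < δ) (fun i ξ q _ _ => by
      obtain ⟨x, η, h1, h2, h3, h4, h5, h6⟩ := h.exists_small_P q hδ
      exact ⟨x, η, ⟨h3, h4, h5⟩, h1, h2, h6.le, fun hodd => absurd hc (by simpa using hodd)⟩)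
  have hC0 : 0 ≤ C := (norm_nonneg _).trans (hQ 0 (nn_pos c)).1.1
  have hr : ∀ k, RV C (q k) (x k) := fun k => by
    rcases lt_or_ge k (nn c) with hk | hk
    · exact (hQ k hk).1
    · rw [hch.zero k hk]
      refine ⟨by simpa using hC0, fun γ _ => ?_⟩
      have := (ww_pos (wt γ)).le
      simp only [map_zero, norm_zero]; positivity
  have hpq (k : ℕ) : p ≤ q k :=
    (le_max_left _ _).trans (hch.le_p.trans (hch.blocks.mono.monotone (Nat.zero_le k)))
  refine ⟨((mm c : ℝ) / nn c) • ∑ k ∈ range (nn c), x k, ξ (nn c), ⟨q (nn c), ?_⟩, ?_,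
    hch.wt_eq _, hch.blocks.exactV hr ((le_max_right _ _).trans hch.le_p), ?_, ?_, ?_⟩
  · rw [map_smul, map_sum]
    congr 1
    refine sum_congr rfl fun k hk => ?_
    exact P_of_le (hch.blocks.mono.monotone (mem_range.1 hk)) (hch.blocks.right k)
  · rw [map_smul, map_sum, sum_eq_zero, smul_zero]
    exact fun k _ => P_eq_zero_of_le (hpq k) (hch.blocks.left k)
  · rw [map_smul]
    refine (norm_scaled_sub_le rfl (f := fun k => e (η k) (x k)) (δ' := 0)
      (fun i hi => (hQ i hi).2.1.le) ?_).trans_lt ?_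
    · rw [mul_zero, map_sum, map_sum, smul_sum, ← sum_sub_distrib, sum_eq_zero, norm_zero]
      intro k hk
      rw [hch.e_index le_rfl, if_pos (mem_range.1 hk), sub_self]
    · nlinarith
  · rw [map_smul, map_smul]
    refine (norm_scaled_sub_le rfl (f := fun k => e (η k) (T (x k))) (δ' := 4 * δ)
      (fun i hi => (hQ i hi).2.2.le) hch.est).trans_lt ?_
    nlinarith
  · rw [map_smul, map_smul, norm_smul, Real.norm_of_nonneg (by positivity), map_sum, map_sum]
    have h1 : ‖∑ k ∈ range (nn c), P p (T (x k))‖ ≤ nn c * (2 * δ) := by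
      refine (norm_sum_le_of_le _ fun k hk => ?_).trans
        (by rw [sum_const, card_range, nsmul_eq_mul])
      have h2 := P_P p (q k) (T (x k))
      rw [min_eq_left (hpq k)] at h2
      rw [← h2]
      linarith [norm_P_le p (P (q k) (T (x k))), hch.small k (mem_range.1 hk)]
    have h3 : (mm c : ℝ) / nn c * (nn c * (2 * δ)) = mm c * (2 * δ) := by field_simp
    have h4 := mul_le_mul_of_nonneg_left h1 (show 0 ≤ (mm c : ℝ) / nn c by positivity)
    nlinarith

lemma Cluster.apply_u [FiniteDimensional ℝ V] {T : X u →L[ℝ] X u} {C : ℝ} {a v : V}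
    (h : Cluster T C a v) : Cluster T (6 * C) (u a) (u v) := by
  intro p ε hε
  obtain ⟨z, ζ, h1, h2, -, h4, h5, h6, -⟩ := h.exists_exact (even_two_mul p) p hε
  exact ⟨z, ζ, h1, h2, ⟨h4.norm_le, fun γ hγ => h4.low γ (by omega)⟩, h5, h6⟩

lemma norm_neg_one_pow_smul {E : Type} [NormedAddCommGroup E] [NormedSpace ℝ E] (i : ℕ) (y : E) :
    ‖(-1 : ℝ) ^ i • y‖ = ‖y‖ := by
  rw [norm_smul, norm_pow, norm_neg, norm_one, one_pow, one_mul]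

lemma ExactV.sign {C : ℝ} {c : ℕ} {z : X u} (h : ExactV C c z) (i : ℕ) :
    ExactV C c ((-1 : ℝ) ^ i • z) := by
  refine ⟨?_, fun γ hγ => ?_, fun γ hγ => ?_, fun γ => ?_⟩
  · exact (norm_neg_one_pow_smul i z).trans_le h.norm_le
  · rw [map_smul, norm_neg_one_pow_smul]; exact h.low γ hγ
  · rw [map_smul, norm_neg_one_pow_smul]; exact h.high γ hγ
  · rw [map_smul, norm_neg_one_pow_smul]; exact h.d_le γ

lemma ExactV.tail_le {C : ℝ} {c j p η : ℕ} {z : X u} (h : ExactV C c z) (hj : j < c)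
    (hjη : j < wt η) (hne : wt η ≠ c) : ‖e η z - e η (P p z)‖ ≤ 36 * C * ww (j + 1) := by
  have hC : 0 ≤ C := by linarith [norm_nonneg z, h.norm_le]
  have hle : ww (wt η) ≤ ww (j + 1) := ww_anti hjη
  have hle' : ww c ≤ ww (j + 1) := ww_anti hj
  have hW := ww_pos (wt η)
  have hWc := ww_pos c
  have h0 := norm_sub_le (e η z) (e η (P p z))
  have h4 : 4 * ww (wt η) * ‖z‖ ≤ 4 * ww (wt η) * (6 * C) :=
    mul_le_mul_of_nonneg_left h.norm_le (by positivity)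
  rcases lt_or_gt_of_ne hne with h1 | h1
  · have h2 := h.low η h1
    have h3 := norm_e_P_le (p := p) (x := z) (B := 6 * C * ww (wt η)) (by positivity)
      (fun γ _ hγ => (h.low γ (hγ ▸ h1)).trans (by rw [hγ])) (γ := η) rfl
    nlinarith
  · have h2 := h.high η h1
    have h3 := norm_e_P_le (p := p) (x := z) (B := 2 * C * ww c) (by positivity)
      (fun γ _ hγ => (h.high γ (hγ ▸ h1))) (γ := η) rfl
    nlinarith

/-- The data of a chain of alternating exact vectors. -/
structure DepChain (T : X u →L[ℝ] X u) (C : ℝ) (a : V) (j : ℕ) (ξ p η : ℕ → ℕ)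
    (x : ℕ → X u) : Prop where
  chain : Chain T j 0 (1 / nn j) ξ p η x
  odd : Odd j
  nonneg : 0 ≤ C
  exact : ∀ k < nn j, ExactV C (2 * ξ k + 2) (x k)
  val : ∀ k < nn j, ‖e (η k) (x k) - (-1 : ℝ) ^ k • u a‖ ≤ 1 / nn j

namespace DepChain

variable {T : X u →L[ℝ] X u} {C : ℝ} {a : V} {j : ℕ} {ξ p η : ℕ → ℕ} {x : ℕ → X u}

lemma lt_weight (h : DepChain T C a j ξ p η x) (k : ℕ) : j < 2 * ξ k + 2 := by
  have := wt_le (ξ k)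
  rw [h.chain.wt_eq] at this
  omega

lemma xi_lt (h : DepChain T C a j ξ p η x) {k l : ℕ} (hkl : k < l) (hl : l ≤ nn j) :
    ξ k < ξ l := by
  induction l with
  | zero => omega
  | succ l ih =>
    obtain ⟨h1, h2, -⟩ := pred_spec (h.chain.pred_eq l hl)
    rcases (Nat.lt_succ_iff_lt_or_eq.1 hkl) with h3 | rfl
    · exact (ih h3 (by omega)).trans (h1.trans h2)
    · exact h1.trans h2

lemma xi_injective (h : DepChain T C a j ξ p η x) {k l : ℕ} (hk : k ≤ nn j) (hl : l ≤ nn j)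
    (heq : ξ k = ξ l) : k = l := by
  rcases lt_trichotomy k l with h1 | h1 | h1
  · exact absurd heq (h.xi_lt h1 hl).ne
  · exact h1
  · exact absurd heq.symm (h.xi_lt h1 hk).ne

lemma norm_le (h : DepChain T C a j ξ p η x) (k : ℕ) : ‖x k‖ ≤ 6 * C := by
  rcases lt_or_ge k (nn j) with hk | hk
  · exact (h.exact k hk).norm_le
  · rw [h.chain.zero k hk, norm_zero]; linarith [h.nonneg]

lemma low (h : DepChain T C a j ξ p η x) (k γ : ℕ) (hγ : wt γ < j) :
    ‖e γ (x k)‖ ≤ 6 * C * ww (wt γ) := by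
  rcases lt_or_ge k (nn j) with hk | hk
  · exact (h.exact k hk).low γ (hγ.trans (h.lt_weight k))
  · have := ww_pos (wt γ)
    have := h.nonneg
    rw [h.chain.zero k hk, map_zero, norm_zero]; positivity

lemma d_le (h : DepChain T C a j ξ p η x) (γ : ℕ) (S : Finset ℕ) :
    ‖d γ (∑ k ∈ S, x k)‖ ≤ 3 * C * ww (j + 1) := by
  have hW := ww_pos (j + 1)
  have hC := h.nonneg
  refine h.chain.blocks.d_sum_le γ (by positivity) (fun k => ?_) S
  rcases lt_or_ge k (nn j) with hk | hk
  · refine ((h.exact k hk).d_le γ).trans ?_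
    have : ww (2 * ξ k + 2) ≤ ww (j + 1) := ww_anti (h.lt_weight k)
    gcongr
  · rw [h.chain.zero k hk, map_zero, norm_zero]; positivity

lemma main_le (h : DepChain T C a j ξ p η x) {s : ℕ} (hs : s ≤ nn j) (l b : ℕ) :
    ‖e (ξ s) (∑ k ∈ Ico l b, x k)‖ ≤ ‖a‖ + 1 := by
  have hn := nnr_pos j
  have h1 : ∑ k ∈ Ico l b, e (ξ s) (x k) =
      ww j • u (∑ k ∈ Ico l (min b s), e (η k) (x k)) := by
    rw [map_sum, smul_sum]
    symm
    refine sum_subset_zero_on_sdiff (Ico_subset_Ico le_rfl (min_le_left _ _))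
      (fun k hk => ?_) fun k hk => ?_
    · rw [h.chain.e_index hs, if_neg]
      have h1 := Finset.mem_Ico.1 (Finset.mem_sdiff.1 hk).1
      exact fun hks => (Finset.mem_sdiff.1 hk).2 (Finset.mem_Ico.2 ⟨h1.1, lt_min h1.2 hks⟩)
    · rw [h.chain.e_index hs, if_pos]
      have := mem_Ico.1 hk
      omega
  have h2 : ‖∑ k ∈ Ico l (min b s), (e (η k) (x k) - (-1 : ℝ) ^ k • u a)‖ ≤ 1 := by
    refine (norm_sum_le_of_le _ fun k hk => h.val k ?_).trans ?_
    · have := mem_Ico.1 hk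
      omega
    · rw [sum_const, nsmul_eq_mul, mul_one_div, div_le_one hn, Nat.card_Ico]
      exact_mod_cast (by omega)
  have h3 : ‖∑ k ∈ Ico l (min b s), (-1 : ℝ) ^ k • u a‖ ≤ ‖a‖ := by
    rw [← sum_smul, norm_smul, Real.norm_eq_abs]
    exact (mul_le_of_le_one_left (norm_nonneg _) (abs_sum_neg_one_pow_le _ _)).trans
      (norm_u_le hu.out a)
  have h4 : ‖∑ k ∈ Ico l (min b s), e (η k) (x k)‖ ≤ ‖a‖ + 1 := by
    have := norm_add_le_of_le h2 h3
    rw [← sum_add_distrib] at this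
    simp only [sub_add_cancel] at this
    linarith
  rw [map_sum, h1, norm_smul, Real.norm_of_nonneg (ww_pos j).le]
  have h5 := (norm_u_le hu.out (∑ k ∈ Ico l (min b s), e (η k) (x k))).trans h4
  nlinarith [ww_le j, ww_pos j, norm_nonneg (u (∑ k ∈ Ico l (min b s), e (η k) (x k)))]

lemma tail_sum_le (h : DepChain T C a j ξ p η x) {η' p' κ : ℕ} {B : ℝ} (hB : 0 ≤ B)
    (hη : j < wt η') (hne : ∀ k < nn j, k ≠ κ → wt η' ≠ 2 * ξ k + 2)
    (hκ : κ < nn j → ‖e η' (x κ) - e η' (P p' (x κ))‖ ≤ B)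
    (l : ℕ) {b : ℕ} (hb : b ≤ nn j) :
    ‖e η' (∑ k ∈ Ico l b, x k) - e η' (P p' (∑ k ∈ Ico l b, x k))‖ ≤
      36 * C * nn j * ww (j + 1) + B := by
  have hW := ww_pos (j + 1)
  have hC := h.nonneg
  rw [map_sum, map_sum, map_sum, ← sum_sub_distrib]
  refine (norm_sum_le_of_exception hB (κ := κ) (A := 36 * C * ww (j + 1)) (fun k hk hk' => ?_)
    fun hk => ?_).trans ?_
  · have hkn : k < nn j := (mem_Ico.1 hk).2.trans_le hb
    exact (h.exact k hkn).tail_le (h.lt_weight k) hη (hne k hkn hk')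
  · have := hκ ((mem_Ico.1 hk).2.trans_le hb)
    have : 0 ≤ 36 * C * ww (j + 1) := by positivity
    linarith
  · have : (#(Ico l b) : ℝ) ≤ nn j := by
      rw [Nat.card_Ico]; exact_mod_cast (by omega)
    have h2 : 0 ≤ 36 * C * ww (j + 1) := by positivity
    nlinarith

lemma same_weight_le (h : DepChain T C a j ξ p η x) {γ : ℕ} (hγ : wt γ = j) (l : ℕ) {b : ℕ}
    (hb : b ≤ nn j) : ‖e γ (∑ k ∈ Ico l b, x k)‖ ≤
      ‖a‖ + 1 + 18 * C + age γ * (39 * C * nn j * ww (j + 1)) := by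
  have hW := ww_pos (j + 1)
  have hC := h.nonneg
  have hn : (1 : ℝ) ≤ nn j := by exact_mod_cast nn_pos j
  have hd := fun γ => h.d_le γ (Ico l b)
  induction γ using pred_induction with
  | hroot γ h1 =>
    rw [e_root h1]
    have h2 := ww_le (j + 1)
    have h3 : 0 ≤ (age γ : ℝ) * (39 * C * nn j * ww (j + 1)) := by positivity
    nlinarith [hd γ, norm_nonneg a]
  | hsucc γ ξ' p' η' h1 ih =>
    by_cases hmain : ∃ s ≤ nn j, ξ s = γ
    · obtain ⟨s, hs, rfl⟩ := hmain
      have := h.main_le hs l b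
      have : 0 ≤ (age (ξ s) : ℝ) * (39 * C * nn j * ww (j + 1)) := by positivity
      linarith
    obtain ⟨h3, h4, h5, h6, h7, h8, h9⟩ := pred_spec h1
    have hξ : wt ξ' = j := h6.symm.trans hγ
    have hη := h9 (hξ ▸ h.odd)
    have hjη : j < wt η' := by
      have := wt_le ξ'
      omega
    have e1 : ∀ {B D : ℝ}, ‖e ξ' (∑ k ∈ Ico l b, x k)‖ ≤ D →
        ‖e η' (∑ k ∈ Ico l b, x k) - e η' (P p' (∑ k ∈ Ico l b, x k))‖ ≤ B →
        ‖e γ (∑ k ∈ Ico l b, x k)‖ ≤ 3 * C * ww (j + 1) + D + B := by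
      intro B D hD hB
      rw [e_succ h1]
      refine norm_add₃_le.trans (add_le_add (add_le_add (hd γ) hD) ?_)
      rw [norm_smul, Real.norm_of_nonneg (ww_pos _).le]
      have h10 := (norm_u_le hu.out _).trans hB
      nlinarith [ww_le (wt γ), ww_pos (wt γ), norm_nonneg (u (e η' (∑ k ∈ Ico l b, x k) -
        e η' (P p' (∑ k ∈ Ico l b, x k))))]
    have hmul : 3 * C * ww (j + 1) ≤ 3 * C * nn j * ww (j + 1) := by
      have : 0 ≤ 3 * C * ww (j + 1) := by positivity
      nlinarith
    have hage : (age γ : ℝ) = age ξ' + 1 := by rw [h7]; push_cast; ring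
    by_cases hmain' : ∃ s ≤ nn j, ξ s = ξ'
    · obtain ⟨s, hs, rfl⟩ := hmain'
      have t1 := h.tail_sum_le (η' := η') (p' := p') (κ := s) (B := 18 * C) (by positivity) hjη
        (fun k hk hks heq => hks (h.xi_injective hk.le hs (by omega))) (fun _ => by
          have := norm_sub_le (e η' (x s)) (e η' (P p' (x s)))
          linarith [norm_e_le η' (x s), norm_e_le η' (P p' (x s)), norm_P_le p' (x s),
            h.norm_le s]) l hb
      have t2 := e1 (h.main_le hs l b) t1
      have : 0 ≤ (age (ξ s) : ℝ) * (39 * C * nn j * ww (j + 1)) := by positivity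
      rw [hage]
      linarith
    · have t1 := h.tail_sum_le (η' := η') (p' := p') (κ := nn j) (B := 0) le_rfl hjη
        (fun k hk _ heq => hmain' ⟨k, hk.le, by omega⟩) (fun hk => absurd hk (lt_irrefl _)) l hb
      have t2 := e1 (ih ξ' (by omega) hξ) t1
      rw [hage]
      linarith

lemma high_weight_le (h : DepChain T C a j ξ p η x) {γ : ℕ} (hγ : j < wt γ) (S : Finset ℕ) :
    ‖e γ (∑ k ∈ S, x k)‖ ≤ 6 * C * ww (j + 1) * #S + 6 * C := by
  have hC := h.nonneg
  have hW := ww_pos (j + 1)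
  have hA : 0 ≤ 6 * C * ww (j + 1) := by positivity
  obtain ⟨κ, hκ⟩ : ∃ κ, ∀ k < nn j, k ≠ κ → wt γ ≠ 2 * ξ k + 2 := by
    by_cases hex : ∃ κ < nn j, wt γ = 2 * ξ κ + 2
    · obtain ⟨κ, h1, h2⟩ := hex
      exact ⟨κ, fun k hk hk' heq => hk' (h.xi_injective hk.le h1.le (by omega))⟩
    · push Not at hex
      exact ⟨0, fun k hk _ => hex k hk⟩
  rw [map_sum]
  refine norm_sum_le_of_exception (by positivity) (κ := κ) (fun k _ hk' => ?_) fun _ => ?_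
  · rcases lt_or_ge k (nn j) with hk | hk
    · rcases lt_or_gt_of_ne (hκ k hk hk') with h1 | h1
      · refine ((h.exact k hk).low γ h1).trans ?_
        have : ww (wt γ) ≤ ww (j + 1) := ww_anti hγ
        gcongr
      · refine ((h.exact k hk).high γ h1).trans ?_
        have : ww (2 * ξ k + 2) ≤ ww (j + 1) := ww_anti (h.lt_weight k)
        have := ww_pos (2 * ξ k + 2)
        nlinarith
    · rw [h.chain.zero k hk, map_zero, norm_zero]; exact hA
  · linarith [norm_e_le γ (x κ), h.norm_le κ]

lemma sum_norm_le (h : DepChain T C a j ξ p η x) :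
    ‖∑ k ∈ range (nn j), x k‖ ≤ 6 * (‖a‖ + 1 + 100 * C) * (nn j / (mm j : ℝ) ^ 2) := by
  have hC := h.nonneg
  have hm := mm_pos j
  have hn := nnr_pos j
  have hW := ww_pos (j + 1)
  have hK : 0 ≤ ‖a‖ + 1 + 100 * C := by positivity
  have hWm : ww (j + 1) * (mm j : ℝ) ^ 2 ≤ 1 := by
    rw [ww, inv_mul_le_one₀ (mm_pos _)]
    exact_mod_cast sq_mm_le_mm (Nat.lt_succ_self j)
  have hWn : (nn j : ℝ) * nn j * ww (j + 1) ≤ 1 := by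
    rw [← sq, ww, ← div_eq_mul_inv, div_le_one (mm_pos _)]
    exact_mod_cast sq_nn_le_mm (Nat.lt_succ_self j)
  refine norm_le_of (by positivity) fun γ => (rec_final h.chain.blocks (by positivity) le_rfl
    (fun k => (h.norm_le k).trans (by linarith [norm_nonneg a])) (fun k γ hγ => (h.low k γ hγ).trans
      (mul_le_mul_of_nonneg_right (by linarith [norm_nonneg a]) (ww_pos _).le))
    (fun γ hγ l b hlb => ?_) γ).1
  have hlen : (0 : ℝ) ≤ (b : ℝ) - l := by simpa using hlb
  have hq : 0 ≤ ((b : ℝ) - l) / (mm j : ℝ) ^ 2 := by positivity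
  rcases hγ.eq_or_lt with h1 | h1
  · have h2 : ∑ k ∈ Ico l b, x k = ∑ k ∈ Ico l (min b (nn j)), x k := by
      symm
      refine sum_subset (Ico_subset_Ico le_rfl (min_le_left _ _)) fun k hk hk' => ?_
      rw [mem_Ico] at hk hk'
      exact h.chain.zero k (by omega)
    rw [h2]
    refine (h.same_weight_le h1.symm l (min_le_right _ _)).trans ?_
    have h3 : (age γ : ℝ) ≤ nn j := by
      have := age_le γ
      rw [← h1] at this
      exact_mod_cast this
    have h4 : (age γ : ℝ) * (39 * C * nn j * ww (j + 1)) ≤ 39 * C := by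
      calc _ ≤ (nn j : ℝ) * (39 * C * nn j * ww (j + 1)) := by gcongr
        _ = 39 * C * (nn j * nn j * ww (j + 1)) := by ring
        _ ≤ 39 * C := mul_le_of_le_one_right (by positivity) hWn
    nlinarith [mul_nonneg hK hq]
  · refine (h.high_weight_le h1 _).trans ?_
    rw [Nat.card_Ico, Nat.cast_sub hlb]
    have h3 : ww (j + 1) ≤ 1 / (mm j : ℝ) ^ 2 := by
      rwa [le_div_iff₀ (by positivity)]
    have h4 : 6 * C * ww (j + 1) * ((b : ℝ) - l) ≤ 6 * C * (((b : ℝ) - l) / (mm j : ℝ) ^ 2) := by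
      rw [mul_assoc, div_eq_mul_one_div, mul_comm ((b : ℝ) - l)]
      gcongr
    nlinarith [mul_nonneg hC hq, norm_nonneg a, mul_nonneg (norm_nonneg a) hq]

end DepChain

lemma Cluster.separation_le [FiniteDimensional ℝ V] {T : X u →L[ℝ] X u} {C : ℝ} {a v v' : V}
    (h : Cluster T C a v) (h' : Cluster T C a v') {j : ℕ} (hj : Odd j) :
    mm j * ‖u (u (v - v'))‖ ≤ 2 * (‖T‖ * (6 * (‖a‖ + 1 + 100 * C)) + 5) := by
  have hm := mm_pos j
  have hn := nnr_pos j
  obtain ⟨ξ, p, η, x, hch, hQ⟩ := exists_chain T j 0 (δ := 1 / nn j) (by positivity)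
    (Q := fun i ξ _ x η => ExactV C (2 * ξ + 2) x ∧ ‖e η x - (-1 : ℝ) ^ i • u a‖ ≤ 1 / nn j ∧
      ‖e η (T x) - (-1 : ℝ) ^ i • (if Even i then u v else u v')‖ ≤ 1 / nn j)
    (fun i ξ p _ _ => by
      have hcl : Cluster T C a (if Even i then v else v') := by split_ifs <;> assumption
      obtain ⟨z, ζ, h1, h2, h3, h4, h5, h6, h7⟩ := hcl.exists_exact
        (c := 2 * ξ + 2) (by simp [parity_simps]) p (show 0 < 1 / (nn j : ℝ) by positivity)
      refine ⟨(-1 : ℝ) ^ i • z, ζ, ⟨h4.sign i, ?_, ?_⟩, ?_, ?_, ?_, fun _ => h3⟩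
      · rw [map_smul, ← smul_sub, norm_neg_one_pow_smul]; exact h5.le
      · rw [map_smul, map_smul, ← smul_sub, norm_neg_one_pow_smul, ← apply_ite u]; exact h6.le
      · obtain ⟨t, ht⟩ := h1
        exact ⟨t, by rw [map_smul, ht]⟩
      · rw [map_smul, h2, smul_zero]
      · rw [map_smul, map_smul]
        exact (norm_neg_one_pow_smul i (P p (T z))).trans_le h7.le)
  have hC : 0 ≤ C := by linarith [norm_nonneg (x 0), (hQ 0 (nn_pos j)).1.norm_le]
  have hdep : DepChain T C a j ξ p η x :=
    ⟨hch, hj, hC, fun k hk => (hQ k hk).1, fun k hk => (hQ k hk).2.1⟩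
  obtain ⟨m, hmn⟩ := (even_nn j).exists_two_nsmul
  rw [smul_eq_mul] at hmn
  have h1 : ‖∑ k ∈ range (nn j), e (η k) (T (x k)) - (m : ℝ) • (u v - u v')‖ ≤ 1 := by
    rw [← sum_alternating, ← hmn, ← sum_sub_distrib]
    refine (norm_sum_le_of_le _ fun k hk => (hQ k (mem_range.1 hk)).2.2).trans ?_
    rw [sum_const, card_range, nsmul_eq_mul, mul_one_div, div_self hn.ne']
  have h2 : ww j * (m * ‖u (u (v - v'))‖) ≤
      ‖ww j • u (∑ k ∈ range (nn j), e (η k) (T (x k)))‖ + 1 := by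
    have h3 : ww j • u ((m : ℝ) • (u v - u v')) =
        ww j • u (∑ k ∈ range (nn j), e (η k) (T (x k))) -
          ww j • u (∑ k ∈ range (nn j), e (η k) (T (x k)) - (m : ℝ) • (u v - u v')) := by
      rw [← smul_sub, map_sub u _ ((m : ℝ) • (u v - u v')), sub_sub_cancel]
    have h4 : ww j * (m * ‖u (u (v - v'))‖) = ‖ww j • u ((m : ℝ) • (u v - u v'))‖ := by
      rw [norm_smul, map_smul, norm_smul, Real.norm_of_nonneg (ww_pos j).le, Real.norm_natCast,
        map_sub u v v']
    rw [h4, h3]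
    refine (norm_sub_le _ _).trans (add_le_add le_rfl ?_)
    rw [norm_smul, Real.norm_of_nonneg (ww_pos j).le]
    have h5 := (norm_u_le hu.out _).trans h1
    nlinarith [ww_le j, ww_pos j, norm_nonneg (u (∑ k ∈ range (nn j), e (η k) (T (x k)) -
      (m : ℝ) • (u v - u v')))]
  have h6 := hch.est
  have h7 : (nn j : ℝ) * (4 * (1 / nn j)) = 4 := by field_simp
  rw [h7] at h6
  have h8 := norm_sub_norm_le (ww j • u (∑ k ∈ range (nn j), e (η k) (T (x k))))
    (e (ξ (nn j)) (T (∑ k ∈ range (nn j), x k)))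
  rw [norm_sub_rev] at h8
  have h9 := (norm_e_le (ξ (nn j)) (T (∑ k ∈ range (nn j), x k))).trans ((T.le_opNorm _).trans
    (mul_le_mul_of_nonneg_left hdep.sum_norm_le (norm_nonneg T)))
  have h10 : ww j * (m * ‖u (u (v - v'))‖) ≤
      ‖T‖ * (6 * (‖a‖ + 1 + 100 * C) * (nn j / (mm j : ℝ) ^ 2)) + 5 := by linarith
  have h11 : (1 : ℝ) ≤ nn j / (mm j : ℝ) ^ 2 := by
    rw [le_div_iff₀ (by positivity), one_mul]; exact_mod_cast sq_mm_le_nn j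
  have h12 : ww j * (m * ‖u (u (v - v'))‖) =
      nn j / (mm j : ℝ) ^ 2 * (mm j * ‖u (u (v - v'))‖ / 2) := by
    rw [ww, hmn]; push_cast; field_simp
  have h13 : nn j / (mm j : ℝ) ^ 2 * (mm j * ‖u (u (v - v'))‖ / 2) ≤
      nn j / (mm j : ℝ) ^ 2 * (‖T‖ * (6 * (‖a‖ + 1 + 100 * C)) + 5) := by
    rw [← h12]
    refine h10.trans ?_
    nlinarith
  have := le_of_mul_le_mul_left h13 (by linarith)
  linarith

lemma Cluster.unique [FiniteDimensional ℝ V] (hinj : Function.Injective u) {T : X u →L[ℝ] X u}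
    {C : ℝ} {a v v' : V} (h : Cluster T C a v) (h' : Cluster T C a v') : v = v' := by
  by_contra hne
  have h0 : 0 < ‖u (u (v - v'))‖ := norm_pos_iff.2 fun h0 => by
    rw [← map_zero u] at h0
    have := hinj h0
    rw [← map_zero u] at this
    exact hne (sub_eq_zero.1 (hinj this))
  obtain ⟨i, hi⟩ := exists_nat_gt
    (2 * (‖T‖ * (6 * (‖a‖ + 1 + 100 * C)) + 5) / ‖u (u (v - v'))‖)
  have h1 := h.separation_le h' (odd_two_mul_add_one i)
  rw [div_lt_iff₀ h0] at hi
  have h2 : (i : ℝ) ≤ mm (2 * i + 1) := by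
    have : 2 * i + 1 ≤ mm (2 * i + 1) := mm_strictMono.le_apply
    exact_mod_cast (by omega)
  nlinarith

end Uniqueness

section Structure

variable {V : Type} [NormedAddCommGroup V] [NormedSpace ℝ V] {u : V →L[ℝ] V}
  [hu : Fact (‖u‖ ≤ 1)]

lemma mkX_eq_zero {n : ℕ} {y : ℕ → V} (h : ∀ γ < n, y γ = 0) : mkX (u := u) n y = 0 := by
  refine ext_e fun δ => ?_
  rw [e_mkX, Rv_congr (z := 0) _ h]
  simpa using Rv_smul (u := u) n 0 (0 : ℕ → V) δ

lemma norm_mkX_le {q : ℕ} {y : ℕ → V} {R : ℝ} (hR : 0 ≤ R) (hy : ∀ γ < q, ‖y γ‖ ≤ R) :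
    ‖mkX (u := u) q y‖ ≤ 2 * R :=
  norm_le_of (by positivity) fun δ => Rv_norm_le hR hy δ

lemma norm_e_mkX_le {q γ : ℕ} {y : ℕ → V} {R : ℝ} (hR : 0 ≤ R) (hy : ∀ γ < q, ‖y γ‖ ≤ R)
    (h : ∀ δ < q, wt δ = wt γ → y δ = 0) : ‖e γ (mkX (u := u) q y)‖ ≤ 8 * R * ww (wt γ) := by
  have h1 := norm_e_P_le (p := q) (x := mkX (u := u) q y) le_rfl (fun δ hδ hδ' => by
    rw [e_mkX, Rv_lt _ hδ, h δ hδ hδ', norm_zero]) (γ := γ) rfl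
  rw [P_mkX, min_self] at h1
  have := norm_mkX_le (u := u) hR hy
  nlinarith [ww_pos (wt γ)]

lemma rv_mkX_high {q J : ℕ} {y : ℕ → V} {R : ℝ} (hR : 0 ≤ R) (hy : ∀ γ < q, ‖y γ‖ ≤ R)
    (h : ∀ γ < q, wt γ < J → y γ = 0) : RV (8 * R) J (mkX (u := u) q y) :=
  ⟨(norm_mkX_le hR hy).trans (by linarith), fun _ hγ =>
    norm_e_mkX_le hR hy fun δ hδ hδ' => h δ hδ (hδ' ▸ hγ)⟩

lemma rv_mkX_low {q J : ℕ} {y : ℕ → V} {R : ℝ} (hR : 0 ≤ R) (hy : ∀ γ < q, ‖y γ‖ ≤ R)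
    (h : ∀ γ < q, J ≤ wt γ → y γ = 0) (j : ℕ) : RV (2 * mm J * R) j (mkX (u := u) q y) := by
  have hm : (4 : ℝ) ≤ mm J := by exact_mod_cast four_le_mm J
  refine ⟨(norm_mkX_le hR hy).trans (by nlinarith), fun γ _ => ?_⟩
  have hW := ww_pos (wt γ)
  rcases lt_or_ge (wt γ) J with h1 | h1
  · have h2 := (norm_e_le γ _).trans (norm_mkX_le (u := u) hR hy)
    have h3 : (1 : ℝ) ≤ mm J * ww (wt γ) := by
      rw [← ww_mul_mm J, mul_comm]
      exact mul_le_mul_of_nonneg_left (ww_anti h1.le) (by positivity)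
    nlinarith
  · refine (norm_e_mkX_le hR hy fun δ hδ hδ' => h δ hδ (hδ' ▸ h1)).trans ?_
    gcongr
    linarith

lemma rv_b {γ : ℕ} (hγ : wt γ = 0) (a : V) (j : ℕ) :
    RV (2 * mm 1 * ‖a‖) j (b (u := u) γ a) := by
  refine rv_mkX_low (norm_nonneg a) (fun δ _ => ?_) (fun δ _ hδ => ?_) j
  · rw [LinearMap.coe_single, Pi.single_apply]
    split_ifs <;> simp
  · rw [LinearMap.coe_single, Pi.single_apply, if_neg]
    rintro rfl
    omega

lemma Cluster.of_tendsto {T : X u →L[ℝ] X u} {C : ℝ} {a v : V} {x : ℕ → X u} {η φ : ℕ → ℕ}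
    (hx : ∀ n, FS (x n) ∧ P n (x n) = 0 ∧ RV C n (x n)) (hφ : StrictMono φ)
    (ha : Tendsto (fun n => e (η (φ n)) (x (φ n))) atTop (𝓝 a))
    (hv : Tendsto (fun n => e (η (φ n)) (T (x (φ n)))) atTop (𝓝 v)) : Cluster T C a v := by
  intro p ε hε
  obtain ⟨n, h1, h2, h3⟩ := ((Metric.tendsto_nhds.1 ha ε hε).and
    ((Metric.tendsto_nhds.1 hv ε hε).and (eventually_ge_atTop p))).exists
  have h4 : p ≤ φ n := h3.trans hφ.le_apply
  obtain ⟨h5, h6, h7⟩ := hx (φ n)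
  rw [dist_eq_norm] at h1 h2
  exact ⟨_, _, h5, P_eq_zero_of_le h4 h6, h7.anti h4, h1, h2⟩

variable [FiniteDimensional ℝ V]

lemma exists_symbol (T : X u →L[ℝ] X u) :
    ∃ M : V →L[ℝ] V, ∀ a, Cluster T (2 * mm 1 * ‖a‖) a (M a) := by
  have : ProperSpace (V →L[ℝ] V) := FiniteDimensional.proper ℝ _
  choose γ hγ hw _ _ using exists_root 0
  let S (n : ℕ) : V →L[ℝ] V :=
    ((e (γ n)).comp T).comp (LinearMap.toContinuousLinearMap (b (γ n)))
  have hS (n : ℕ) (a : V) : S n a = e (γ n) (T (b (γ n) a)) := rfl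
  obtain ⟨M, -, φ, hφ, hM⟩ := tendsto_subseq_of_bounded
    (Metric.isBounded_closedBall (x := (0 : V →L[ℝ] V)) (r := ‖T‖ * 2)) (x := S) fun n => by
      rw [mem_closedBall_zero_iff]
      refine ContinuousLinearMap.opNorm_le_bound _ (by positivity) fun a => ?_
      rw [hS, mul_assoc]
      exact (norm_e_le _ _).trans ((T.le_opNorm _).trans
        (mul_le_mul_of_nonneg_left (norm_b_le _ a) (norm_nonneg T)))
  refine ⟨M, fun a => Cluster.of_tendsto (x := fun n => b (γ n) a) (η := γ) (fun n =>
    ⟨⟨_, P_b _ a⟩, P_b_zero (hγ n) a, rv_b (hw n) a n⟩) hφ ?_ ?_⟩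
  · simp only [e_b]
    exact tendsto_const_nhds
  · exact ((ContinuousLinearMap.apply ℝ V a).continuous.tendsto M).comp hM

lemma exists_commuting_symbol (hinj : Function.Injective u) (T : X u →L[ℝ] X u) :
    ∃ M : V →L[ℝ] V, (∀ v, M (u v) = u (M v)) ∧ ∀ a, Cluster T (2 * mm 1 * ‖a‖) a (M a) := by
  obtain ⟨M, hM⟩ := exists_symbol T
  exact ⟨M, fun v => ((hM (u v)).mono (le_max_left _ _)).unique hinj
    ((hM v).apply_u.mono (le_max_right _ _)), hM⟩

lemma exists_small_of_rv (hinj : Function.Injective u) {T : X u →L[ℝ] X u} {M : V →L[ℝ] V}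
    (hM : ∀ v, M (u v) = u (M v)) (hT : ∀ a, Cluster T (2 * mm 1 * ‖a‖) a (M a)) (C : ℝ) {ε : ℝ}
    (hε : 0 < ε) :
    ∃ p, ∀ x, FS x → P p x = 0 → RV C p x → ‖(T - hat M hM) x‖ ≤ ε := by
  have : ProperSpace V := FiniteDimensional.proper ℝ V
  by_contra! hcon
  have hcon' (n : ℕ) : ∃ x η, (FS x ∧ P n x = 0 ∧ RV C n x) ∧
      ε < ‖e η (T x) - M (e η x)‖ := by
    obtain ⟨x, h1, h2, h3, h4⟩ := hcon n
    by_contra! h5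
    refine h4.not_ge (norm_le_of hε.le fun η => ?_)
    have := h5 x η ⟨h1, h2, h3⟩
    rwa [sub_apply, map_sub, e_hat]
  choose x η hx hlarge using hcon'
  have hb (n : ℕ) : (e (η n) (x n), e (η n) (T (x n))) ∈
      Metric.closedBall (0 : V × V) (max C (‖T‖ * C)) := by
    have h1 := (hx n).2.2.1
    rw [mem_closedBall_zero_iff, Prod.norm_def]
    exact max_le_max ((norm_e_le _ _).trans h1) ((norm_e_le _ _).trans ((T.le_opNorm _).trans
      (mul_le_mul_of_nonneg_left h1 (norm_nonneg T))))
  obtain ⟨⟨a, v⟩, -, φ, hφ, h⟩ := tendsto_subseq_of_bounded Metric.isBounded_closedBall hb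
  have ha : Tendsto (fun n => e (η (φ n)) (x (φ n))) atTop (𝓝 a) :=
    (continuous_fst.tendsto (a, v)).comp h
  have hv : Tendsto (fun n => e (η (φ n)) (T (x (φ n)))) atTop (𝓝 v) :=
    (continuous_snd.tendsto (a, v)).comp h
  have heq : v = M a := ((Cluster.of_tendsto hx hφ ha hv).mono (le_max_left _ _)).unique hinj
    ((hT a).mono (le_max_right _ _))
  have hlim := (hv.sub ((M.continuous.tendsto a).comp ha)).norm
  have := ge_of_tendsto' hlim fun n => (hlarge (φ n)).le
  rw [heq, sub_self, norm_zero] at this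
  linarith

lemma exists_small_of_norm_le (hinj : Function.Injective u) {T : X u →L[ℝ] X u} {M : V →L[ℝ] V}
    (hM : ∀ v, M (u v) = u (M v)) (hT : ∀ a, Cluster T (2 * mm 1 * ‖a‖) a (M a)) {ε : ℝ}
    (hε : 0 < ε) :
    ∃ p, ∀ x, FS x → P p x = 0 → ‖x‖ ≤ 1 → ‖(T - hat M hM) x‖ ≤ ε := by
  obtain ⟨J, hJ⟩ := exists_small_of_rv hinj hM hT (8 * 1) (half_pos hε)
  obtain ⟨p, hp⟩ := exists_small_of_rv hinj hM hT (2 * mm J * 1) (half_pos hε)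
  refine ⟨max J p, fun x ⟨q, hq⟩ hx hx1 => ?_⟩
  let y (s : Set ℕ) : ℕ → V := s.indicator fun γ => e γ x
  have hy (s : Set ℕ) (γ : ℕ) : ‖y s γ‖ ≤ 1 :=
    (norm_indicator_le_norm_self _ _).trans ((norm_e_le γ x).trans hx1)
  have hP {n : ℕ} (hn : n ≤ max J p) (s : Set ℕ) : P n (mkX (u := u) q (y s)) = 0 := by
    rw [P_mkX]
    refine mkX_eq_zero fun γ hγ => ?_
    have : e γ x = 0 := e_eq_zero_of_lt hx (by omega)
    simp [y, Set.indicator, this]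
  have hFS (s : Set ℕ) : FS (mkX (u := u) q (y s)) := ⟨q, by rw [P_mkX, min_self]⟩
  have h1 := hJ _ (hFS {γ | J ≤ wt γ}) (hP (le_max_left _ _) _)
    (rv_mkX_high zero_le_one (fun γ _ => hy _ γ) fun γ _ hγ =>
      Set.indicator_of_notMem (by simpa using hγ) _)
  have h2 := hp _ (hFS {γ | J ≤ wt γ}ᶜ) (hP (le_max_right _ _) _)
    (rv_mkX_low zero_le_one (fun γ _ => hy _ γ) (fun γ _ hγ =>
      Set.indicator_of_notMem (by simpa using hγ) _) p)
  have hsum : x = mkX q (y {γ | J ≤ wt γ}) + mkX q (y {γ | J ≤ wt γ}ᶜ) := by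
    rw [← map_add, Set.indicator_self_add_compl, ← P_eq, hq]
  rw [hsum, map_add]
  exact (norm_add_le_of_le h1 h2).trans_eq (add_halves ε)

/-- Every operator is a compact perturbation of a coordinatewise operator. -/
theorem exists_hat_add_compact (hinj : Function.Injective u) (T : X u →L[ℝ] X u) :
    ∃ (M : V →L[ℝ] V) (hM : ∀ v, M (u v) = u (M v)), IsCompactOperator (T - hat M hM) := by
  obtain ⟨M, hM, hT⟩ := exists_commuting_symbol hinj T
  refine ⟨M, hM, ?_⟩
  have : CompleteSpace V := FiniteDimensional.complete ℝ V
  set S := T - hat M hM with hS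
  refine isCompactOperator_of_tendsto (l := atTop) (F := fun n => S.comp (P n)) ?_
    (Eventually.of_forall fun n => (isCompactOperator_P n).clm_comp S)
  rw [Metric.tendsto_atTop]
  intro ε hε
  obtain ⟨p, hp⟩ := exists_small_of_norm_le hinj hM hT (show 0 < ε / 8 by positivity)
  have hp' (x : X u) (hx : FS x) (hx' : P p x = 0) : ‖S x‖ ≤ ε / 8 * ‖x‖ := by
    rcases eq_or_ne x 0 with rfl | hne
    · simp
    obtain ⟨t, ht⟩ := hx
    have hpos := norm_pos_iff.2 hne
    have := hp (‖x‖⁻¹ • x) ⟨t, by rw [map_smul, ht]⟩ (by rw [map_smul, hx', smul_zero]) (by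
      rw [norm_smul, norm_inv, norm_norm, inv_mul_cancel₀ hpos.ne'])
    rw [map_smul, norm_smul, norm_inv, norm_norm, inv_mul_le_iff₀ hpos] at this
    linarith
  refine ⟨p, fun n hn => ?_⟩
  rw [dist_eq_norm]
  refine (ContinuousLinearMap.opNorm_le_bound _ (show 0 ≤ ε / 2 by positivity) fun x => ?_).trans_lt
    (half_lt_self hε)
  have hlim : Tendsto (fun m => ‖S (P n x - P m x)‖) atTop (𝓝 ‖S (P n x - x)‖) :=
    ((S.continuous.tendsto _).comp (tendsto_const_nhds.sub (tendsto_P x))).norm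
  rw [sub_apply, ContinuousLinearMap.comp_apply, ← map_sub]
  refine le_of_tendsto hlim ((eventually_ge_atTop n).mono fun m hm => ?_)
  refine (hp' _ ⟨m, ?_⟩ ?_).trans ?_
  · rw [map_sub, P_P, P_P, min_eq_right hm, min_self]
  · rw [map_sub, P_P, P_P, min_eq_left hn, min_eq_left (hn.trans hm), sub_self]
  · have := norm_sub_le (P n x) (P m x)
    have := norm_P_le n x
    have := norm_P_le m x
    nlinarith

end Structure

section Ideals

open Polynomial

variable {R : Type*} [Ring R] {K : TwoSidedIdeal R} {D : R}

lemma pow_mem_of_le {J : TwoSidedIdeal R} {s t : ℕ} (hst : s ≤ t) (h : D ^ s ∈ J) : D ^ t ∈ J := by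
  rw [← Nat.sub_add_cancel hst, pow_add]
  exact J.mul_mem_left _ _ h

lemma mul_unit_mem_iff {J : TwoSidedIdeal R} {g : R} (hg : IsUnit g) (x : R) :
    x * g ∈ J ↔ x ∈ J := by
  obtain ⟨g, rfl⟩ := hg
  refine ⟨fun h => ?_, J.mul_mem_right _ _⟩
  simpa using J.mul_mem_right _ (↑g⁻¹) h

lemma mem_iff_of_sub_mem {J : TwoSidedIdeal R} {x y : R} (h : x - y ∈ J) : x ∈ J ↔ y ∈ J :=
  ⟨fun hx => by simpa using J.sub_mem hx h, fun hy => by simpa using J.add_mem h hy⟩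

variable [Algebra ℝ R]

lemma mul_pow_sub_pow_mul_mem (h : ∀ T, ∃ q : ℝ[X], T - aeval D q ∈ K) (T : R) (r : ℕ) :
    T * D ^ r - D ^ r * T ∈ K := by
  obtain ⟨q, hq⟩ := h T
  have hc : aeval D q * D ^ r = D ^ r * aeval D q := by
    rw [← aeval_X_pow (R := ℝ) D, ← map_mul, ← map_mul, mul_comm]
  have heq : T * D ^ r - D ^ r * T =
      (T - aeval D q) * D ^ r - D ^ r * (T - aeval D q) := by
    rw [sub_mul, mul_sub, hc]; abel
  rw [heq]
  exact K.sub_mem (K.mul_mem_right _ _ hq) (K.mul_mem_left _ _ hq)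

/-- The ideal of elements whose product with `D ^ r` lies in `K`. -/
def colon (h : ∀ T, ∃ q : ℝ[X], T - aeval D q ∈ K) (r : ℕ) : TwoSidedIdeal R :=
  TwoSidedIdeal.mk' {T | T * D ^ r ∈ K} (by simp [K.zero_mem])
    (fun {x y} hx hy => by
      rw [Set.mem_ofPred_eq, add_mul]; exact K.add_mem hx hy)
    (fun {x} hx => by rw [Set.mem_ofPred_eq, neg_mul]; exact K.neg_mem hx)
    (fun {x y} hy => by rw [Set.mem_ofPred_eq, mul_assoc]; exact K.mul_mem_left _ _ hy)
    (fun {x y} hx => by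
      have h1 : x * y * D ^ r = x * (y * D ^ r - D ^ r * y) + x * D ^ r * y := by noncomm_ring
      rw [Set.mem_ofPred_eq, h1]
      exact K.add_mem (K.mul_mem_left _ _ (mul_pow_sub_pow_mul_mem h y r))
        (K.mul_mem_right _ _ hx))

lemma mem_colon {h : ∀ T, ∃ q : ℝ[X], T - aeval D q ∈ K} {r : ℕ} {T : R} :
    T ∈ colon h r ↔ T * D ^ r ∈ K :=
  TwoSidedIdeal.mem_mk' _ _ _ _ _ _ _

lemma colon_mono (h : ∀ T, ∃ q : ℝ[X], T - aeval D q ∈ K) : Monotone (colon h) := by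
  refine monotone_nat_of_le_succ fun r T hT => ?_
  rw [mem_colon] at hT ⊢
  rw [pow_succ, ← mul_assoc]
  exact K.mul_mem_right _ _ hT

lemma colon_zero (h : ∀ T, ∃ q : ℝ[X], T - aeval D q ∈ K) : colon h 0 = K :=
  TwoSidedIdeal.ext fun T => by rw [mem_colon, pow_zero, mul_one]

lemma le_colon (h : ∀ T, ∃ q : ℝ[X], T - aeval D q ∈ K) (r : ℕ) : K ≤ colon h r :=
  (colon_zero h).ge.trans (colon_mono h (Nat.zero_le r))

lemma isClosed_colon [TopologicalSpace R] [IsTopologicalRing R] (hK : IsClosed (K : Set R))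
    (h : ∀ T, ∃ q : ℝ[X], T - aeval D q ∈ K) (r : ℕ) : IsClosed (colon h r : Set R) := by
  have : (colon h r : Set R) = (fun T => T * D ^ r) ⁻¹' K := by
    ext T
    exact mem_colon
  rw [this]
  exact hK.preimage (continuous_id.mul continuous_const)

lemma exists_aeval_eq {k : ℕ} (hD : D ^ k = 0) {q : ℝ[X]} (hq : q ≠ 0) :
    ∃ (t : ℕ) (g : R), IsUnit g ∧ aeval D q = D ^ t * g := by
  obtain ⟨g, hg, hg'⟩ := exists_eq_pow_rootMultiplicity_mul_and_not_dvd q hq 0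
  rw [C_0, sub_zero] at hg hg'
  refine ⟨_, aeval D g, ?_, by
    conv_lhs => rw [hg]
    rw [map_mul, map_pow, aeval_X]⟩
  rw [X_dvd_iff] at hg'
  rw [← divX_mul_X_add g, map_add, map_mul, aeval_X, aeval_C]
  have hnil : IsNilpotent (aeval D g.divX * D) := by
    refine Commute.isNilpotent_mul_left ?_ ⟨k, hD⟩
    have := (Commute.all g.divX (Polynomial.X : ℝ[X])).map (aeval D)
    rwa [aeval_X] at this
  exact hnil.isUnit_add_right_of_commute ((isUnit_iff_ne_zero.2 hg').map (algebraMap ℝ R))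
    (Algebra.commutes _ _).symm

variable {k : ℕ}

lemma pow_mem_colon_iff (hD : D ^ k = 0) (hD' : D ^ (k - 1) ∉ K)
    (h : ∀ T, ∃ q : ℝ[X], T - aeval D q ∈ K) {t r : ℕ} : D ^ t ∈ colon h r ↔ k ≤ t + r := by
  rw [mem_colon, ← pow_add]
  refine ⟨fun h1 => ?_, fun h1 => ?_⟩
  · by_contra h2
    exact hD' (pow_mem_of_le (by omega) h1)
  · exact pow_mem_of_le h1 (hD ▸ K.zero_mem)

lemma eq_colon (hD : D ^ k = 0) (hD' : D ^ (k - 1) ∉ K) (h : ∀ T, ∃ q : ℝ[X], T - aeval D q ∈ K)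
    {J : TwoSidedIdeal R} (hKJ : K ≤ J) (hJ : J ≠ ⊤) : ∃ r < k, J = colon h r := by
  classical
  have hex : ∃ s, D ^ s ∈ J := ⟨k, hD ▸ J.zero_mem⟩
  have hs := Nat.find_spec hex
  have hmin : ∀ t, D ^ t ∈ J ↔ Nat.find hex ≤ t :=
    fun t => ⟨Nat.find_min' hex, fun ht => pow_mem_of_le ht hs⟩
  set s := Nat.find hex
  have hs0 : s ≠ 0 := fun h0 => by
    rw [h0, pow_zero] at hs
    exact hJ (top_unique fun T _ => by simpa using J.mul_mem_left T 1 hs)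
  have hsk : s ≤ k := (hmin k).1 (hD ▸ J.zero_mem)
  refine ⟨k - s, by omega, TwoSidedIdeal.ext fun T => ?_⟩
  obtain ⟨q, hq⟩ := h T
  rw [mem_iff_of_sub_mem (hKJ hq), mem_iff_of_sub_mem (le_colon h _ hq)]
  rcases eq_or_ne q 0 with rfl | hq0
  · simp
  · obtain ⟨t, g, hg, hqg⟩ := exists_aeval_eq hD hq0
    rw [hqg, mul_unit_mem_iff hg, mul_unit_mem_iff hg, hmin, pow_mem_colon_iff hD hD']
    omega

/-- The proper closed nonzero ideals are exactly the ideals `colon h r` with `r < k`. -/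
lemma setOf_ideals_eq [TopologicalSpace R] [IsTopologicalRing R] (hK : IsClosed (K : Set R))
    (hK0 : K ≠ ⊥) (hleast : ∀ J : TwoSidedIdeal R, IsClosed (J : Set R) → J ≠ ⊥ → K ≤ J)
    (hD : D ^ k = 0) (hD' : D ^ (k - 1) ∉ K) (h : ∀ T, ∃ q : ℝ[X], T - aeval D q ∈ K) :
    {J : TwoSidedIdeal R | IsClosed (J : Set R) ∧ J ≠ ⊥ ∧ J ≠ ⊤} = colon h '' Set.Iio k := by
  ext J
  refine ⟨fun ⟨h1, h2, h3⟩ => ?_, ?_⟩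
  · obtain ⟨r, hr, hJ⟩ := eq_colon hD hD' h (hleast J h1 h2) h3
    exact ⟨r, hr, hJ.symm⟩
  · rintro ⟨r, hr, rfl⟩
    refine ⟨isClosed_colon hK h r, fun h0 => hK0 ?_, fun h1 => ?_⟩
    · exact bot_unique (h0 ▸ le_colon h r)
    · have : D ^ 0 ∈ colon h r := h1 ▸ trivial
      rw [pow_mem_colon_iff hD hD'] at this
      exact absurd hr (by simpa using this)

lemma injOn_colon (hD : D ^ k = 0) (hD' : D ^ (k - 1) ∉ K)
    (h : ∀ T, ∃ q : ℝ[X], T - aeval D q ∈ K) : Set.InjOn (colon h) (Set.Iio k) := by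
  intro r hr s hs hrs
  have h1 (t : ℕ) : k ≤ t + r ↔ k ≤ t + s := by
    rw [← pow_mem_colon_iff hD hD' h, hrs, pow_mem_colon_iff hD hD']
  have h2 := h1 (k - r)
  have h3 := h1 (k - s)
  rw [Set.mem_Iio] at hr hs
  omega

end Ideals

section Compact

variable {E : Type} [NormedAddCommGroup E] [NormedSpace ℝ E]

variable (E) in
/-- The ideal of compact operators. -/
def compactIdeal : TwoSidedIdeal (E →L[ℝ] E) :=
  TwoSidedIdeal.mk' {T | IsCompactOperator T} isCompactOperator_zero
    (fun hx hy => hx.add hy) (fun hx => hx.neg) (fun {x _} hy => hy.clm_comp x)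
    (fun {_ y} hx => hx.comp_clm y)

lemma coe_compactIdeal :
    (compactIdeal E : Set (E →L[ℝ] E)) = {T : E →L[ℝ] E | IsCompactOperator T} :=
  TwoSidedIdeal.coe_mk' _ _ _ _ _ _

lemma mem_compactIdeal {T : E →L[ℝ] E} : T ∈ compactIdeal E ↔ IsCompactOperator T :=
  TwoSidedIdeal.mem_mk' _ _ _ _ _ _ _

lemma smulRight_mem {J : TwoSidedIdeal (E →L[ℝ] E)} (hJ : J ≠ ⊥) (f : E →L[ℝ] ℝ) (y : E) :
    f.smulRight y ∈ J := by
  obtain ⟨T, hT, hT0⟩ : ∃ T ∈ J, T ≠ 0 := by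
    by_contra! hcon
    exact hJ (bot_unique fun T hT => (TwoSidedIdeal.mem_bot _).2 (hcon T hT))
  obtain ⟨x, hx⟩ : ∃ x, T x ≠ 0 := by
    by_contra! hcon
    exact hT0 (ContinuousLinearMap.ext hcon)
  obtain ⟨g, hg⟩ := SeparatingDual.exists_eq_one (R := ℝ) hx
  have : f.smulRight y = g.smulRight y * T * f.smulRight x := by
    ext z
    simp [hg]
  rw [this]
  exact J.mul_mem_right _ _ (J.mul_mem_left _ _ hT)

lemma comp_mem_of_finiteDimensional {J : TwoSidedIdeal (E →L[ℝ] E)} (hJ : J ≠ ⊥) {W : Type}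
    [NormedAddCommGroup W] [NormedSpace ℝ W] [FiniteDimensional ℝ W] (f : W →L[ℝ] E)
    (π : E →L[ℝ] W) : f.comp π ∈ J := by
  let B := Module.finBasis ℝ W
  have : f.comp π = ∑ i, ((LinearMap.toContinuousLinearMap (B.coord i)).comp π).smulRight
      (f (B i)) := by
    ext x
    rw [ContinuousLinearMap.comp_apply]
    conv_lhs => rw [← B.sum_repr (π x), map_sum]
    simp
  rw [this]
  exact sum_mem fun i _ => smulRight_mem hJ _ _

variable {V : Type} [NormedAddCommGroup V] [NormedSpace ℝ V] {u : V →L[ℝ] V}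
  [hu : Fact (‖u‖ ≤ 1)]

lemma tendsto_P_comp {S : X u →L[ℝ] X u} (hS : IsCompactOperator S) :
    Tendsto (fun n => (P n).comp S) atTop (𝓝 S) := by
  refine (Metric.tendsto_atTop (u := fun n : ℕ => (P n).comp S) (a := S)).2 fun ε hε => ?_
  obtain ⟨C, hC, hC'⟩ := hS.image_closedBall_subset_compact 1
  obtain ⟨t, ht, hcov⟩ := Metric.totallyBounded_iff.1 hC.totallyBounded (ε / 8) (by positivity)
  have h1 : ∀ᶠ n in atTop, ∀ y ∈ t, ‖P n y - y‖ < ε / 8 :=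
    (ht.eventually_all).2 fun y _ => by
      simpa [dist_eq_norm] using Metric.tendsto_nhds.1 (tendsto_P y) (ε / 8) (by positivity)
  obtain ⟨N, hN⟩ := eventually_atTop.1 h1
  refine ⟨N, fun n hn => ?_⟩
  refine (dist_eq_norm ((P n).comp S) S).trans_lt ?_
  refine (ContinuousLinearMap.opNorm_le_of_unit_norm (show 0 ≤ ε / 2 by positivity)
    fun x hx => ?_).trans_lt (half_lt_self hε)
  obtain ⟨y, hy, hxy⟩ := Set.mem_iUnion₂.1 (hcov (hC' ⟨x, by simp [hx], rfl⟩))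
  replace hxy : ‖S x - y‖ < ε / 8 := by rwa [Metric.mem_ball, dist_eq_norm] at hxy
  have h2 : ((P n).comp S - S) x = P n (S x - y) + (P n y - y) - (S x - y) := by
    rw [sub_apply, ContinuousLinearMap.comp_apply, map_sub]
    abel
  rw [h2]
  have := norm_sub_le (P n (S x - y) + (P n y - y)) (S x - y)
  have := norm_add_le (P n (S x - y)) (P n y - y)
  have := norm_P_le n (S x - y)
  have := hN n hn y hy
  linarith

variable [FiniteDimensional ℝ V]

lemma P_mem {J : TwoSidedIdeal (X u →L[ℝ] X u)} (hJ : J ≠ ⊥) (n : ℕ) : P n ∈ J := by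
  obtain ⟨f, hf, -⟩ := exists_factor_P (u := u) n
  have : P (u := u) n = (LinearMap.toContinuousLinearMap f).comp
      (ContinuousLinearMap.pi fun i : Fin n => e (u := u) i) :=
    ContinuousLinearMap.ext hf
  rw [this]
  exact comp_mem_of_finiteDimensional hJ _ _

lemma compactIdeal_le {J : TwoSidedIdeal (X u →L[ℝ] X u)} (hJ : IsClosed (J : Set (X u →L[ℝ] X u)))
    (hJ0 : J ≠ ⊥) : compactIdeal (X u) ≤ J := fun _ hS =>
  hJ.mem_of_tendsto (tendsto_P_comp (mem_compactIdeal.1 hS))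
    (Eventually.of_forall fun n => J.mul_mem_right _ _ (P_mem hJ0 n))

end Compact

section Shift

open Polynomial

variable (k : ℕ)

/-- The nilpotent shift on `Fin k → ℝ`. -/
noncomputable def shift : (Fin k → ℝ) →L[ℝ] (Fin k → ℝ) :=
  ContinuousLinearMap.pi fun i =>
    if h : (i : ℕ) + 1 < k then ContinuousLinearMap.proj ⟨i + 1, h⟩ else 0

variable {k}

lemma shift_pow_apply (r : ℕ) (x : Fin k → ℝ) (i : Fin k) :
    (shift k ^ r) x i = if h : (i : ℕ) + r < k then x ⟨i + r, h⟩ else 0 := by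
  induction r generalizing x with
  | zero => simp
  | succ r ih =>
    rw [pow_succ, mul_apply_eq_comp, ih]
    by_cases h1 : (i : ℕ) + r < k
    · rw [dif_pos h1]
      by_cases h2 : (i : ℕ) + r + 1 < k
      · have h3 : (i : ℕ) + (r + 1) < k := h2
        simp [shift, h3, add_assoc]
      · have h3 : ¬ (i : ℕ) + (r + 1) < k := h2
        simp [shift, h2, h3]
    · rw [dif_neg h1, dif_neg (by omega)]

lemma shift_pow_self : shift k ^ k = 0 := by
  ext x i
  rw [shift_pow_apply, dif_neg (by omega)]
  rfl

lemma norm_shift_le : ‖shift k‖ ≤ 1 := by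
  refine ContinuousLinearMap.opNorm_le_bound _ zero_le_one fun x => ?_
  rw [one_mul]
  refine (pi_norm_le_iff_of_nonneg (norm_nonneg x)).2 fun i => ?_
  rw [← pow_one (shift k), shift_pow_apply]
  split_ifs
  · exact norm_le_pi_norm x _
  · simp

lemma exists_aeval_shift_eq {M : (Fin k → ℝ) →L[ℝ] (Fin k → ℝ)} (hM : Commute M (shift k)) :
    ∃ q : ℝ[X], M = aeval (shift k) q := by
  rcases Nat.eq_zero_or_pos k with rfl | hk
  · exact ⟨0, Subsingleton.elim _ _⟩
  let i₀ : Fin k := ⟨0, hk⟩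
  have h0 (r : Fin k) (x : Fin k → ℝ) : x r = (shift k ^ (r : ℕ)) x i₀ := by
    rw [shift_pow_apply, dif_pos (by simp [i₀])]
    simp [i₀]
  refine ⟨∑ i : Fin k, M (Pi.single i 1) i₀ • (Polynomial.X : ℝ[X]) ^ (i : ℕ), ?_⟩
  ext x r
  have h1 : (shift k ^ (r : ℕ)) (M x) = M ((shift k ^ (r : ℕ)) x) :=
    (DFunLike.congr_fun (hM.pow_right (r : ℕ)).eq x).symm
  rw [h0 r (M x), h1]
  have h2 (y : Fin k → ℝ) : M y i₀ = ∑ i, y i * M (Pi.single i 1) i₀ := by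
    conv_lhs => rw [pi_eq_sum_univ' y, map_sum]
    simp
  have h3 (i : Fin k) : (shift k ^ (r : ℕ)) x i = (shift k ^ (i : ℕ)) x r := by
    rw [shift_pow_apply, shift_pow_apply]
    simp only [add_comm]
  rw [h2, map_sum, _root_.sum_apply, Finset.sum_apply]
  refine sum_congr rfl fun i _ => ?_
  rw [map_smul, map_pow, aeval_X, smul_apply, Pi.smul_apply, smul_eq_mul, h3, mul_comm]

variable (k) in
/-- An injective contraction with the same commutant as the shift. -/
noncomputable def contraction : (Fin k → ℝ) →L[ℝ] (Fin k → ℝ) := (1 / 2 : ℝ) • (1 + shift k)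

instance : Fact (‖contraction k‖ ≤ 1) := ⟨by
  rw [contraction, norm_smul]
  have h1 : ‖(1 : (Fin k → ℝ) →L[ℝ] (Fin k → ℝ))‖ ≤ 1 := ContinuousLinearMap.norm_id_le
  have := norm_add_le_of_le h1 (norm_shift_le (k := k))
  norm_num
  linarith⟩

lemma contraction_injective : Function.Injective (contraction k) := by
  obtain ⟨g, hg⟩ := (IsNilpotent.isUnit_one_add (r := shift k) ⟨k, shift_pow_self⟩).exists_left_inv
  have h (x : Fin k → ℝ) : (2 : ℝ) • g (contraction k x) = x := by
    have := DFunLike.congr_fun hg x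
    rw [mul_apply_eq_comp, one_apply_eq_self] at this
    rw [contraction, smul_apply, map_smul, smul_smul, this]
    norm_num
  intro x y hxy
  rw [← h x, hxy, h y]

lemma commute_contraction_iff {M : (Fin k → ℝ) →L[ℝ] (Fin k → ℝ)} :
    (∀ v, M (contraction k v) = contraction k (M v)) ↔ Commute M (shift k) := by
  refine ⟨fun h => ContinuousLinearMap.ext fun v => ?_, fun h v => ?_⟩
  · simpa [contraction] using h v
  · have : M (shift k v) = shift k (M v) := DFunLike.congr_fun h.eq v
    simp [contraction, this]

variable (k) in
/-- The operator on the space induced by the shift. -/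
noncomputable def hatShift : X (contraction k) →L[ℝ] X (contraction k) :=
  hat (shift k) (commute_contraction_iff.2 (Commute.refl _))

lemma e_hatShift_pow (r γ : ℕ) (x : X (contraction k)) :
    e γ ((hatShift k ^ r) x) = (shift k ^ r) (e γ x) := by
  induction r generalizing x with
  | zero => rfl
  | succ r ih =>
    rw [pow_succ, pow_succ, mul_apply_eq_comp, mul_apply_eq_comp, ih,
      hatShift, e_hat]

lemma e_aeval_hatShift (q : ℝ[X]) (γ : ℕ) (x : X (contraction k)) :
    e γ (aeval (hatShift k) q x) = aeval (shift k) q (e γ x) := by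
  induction q using Polynomial.induction_on' with
  | add p q hp hq =>
    rw [map_add, map_add, add_apply, add_apply, map_add, hp, hq]
  | monomial r c =>
    rw [← smul_X_eq_monomial, map_smul, map_smul, map_pow, map_pow, aeval_X, aeval_X, smul_apply,
      smul_apply, map_smul, e_hatShift_pow]

lemma hatShift_pow_self : hatShift k ^ k = 0 := by
  refine ContinuousLinearMap.ext fun x => ext_e fun γ => ?_
  rw [e_hatShift_pow, shift_pow_self]
  simp

lemma hatShift_pow_notMem (hk : 0 < k) :
    hatShift k ^ (k - 1) ∉ compactIdeal (X (contraction k)) := by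
  intro h
  have hc : Commute (shift k ^ (k - 1)) (shift k) := (Commute.refl _).pow_left _
  have heq : hatShift k ^ (k - 1) = hat _ (commute_contraction_iff.2 hc) :=
    ContinuousLinearMap.ext fun x => ext_e fun γ => by rw [e_hatShift_pow, e_hat]
  have h0 := eq_zero_of_isCompactOperator_hat _ (heq ▸ mem_compactIdeal.1 h)
  have h1 := congr_fun (DFunLike.congr_fun h0 (fun _ => 1)) ⟨0, hk⟩
  rw [shift_pow_apply, dif_pos (by simp; omega)] at h1
  exact one_ne_zero h1

lemma exists_sub_aeval_mem (T : X (contraction k) →L[ℝ] X (contraction k)) :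
    ∃ q : ℝ[X], T - aeval (hatShift k) q ∈ compactIdeal (X (contraction k)) := by
  obtain ⟨M, hM, hT⟩ := exists_hat_add_compact contraction_injective T
  obtain ⟨q, hq⟩ := exists_aeval_shift_eq (commute_contraction_iff.1 hM)
  refine ⟨q, mem_compactIdeal.2 ?_⟩
  have : aeval (hatShift k) q = hat M hM :=
    ContinuousLinearMap.ext fun x => ext_e fun γ => by rw [e_aeval_hatShift, e_hat, hq]
  rwa [this]

end Shift

section Dimension

variable {V : Type} [NormedAddCommGroup V] [NormedSpace ℝ V] [Nontrivial V] {u : V →L[ℝ] V}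
  [hu : Fact (‖u‖ ≤ 1)]

lemma not_finiteDimensional : ¬ FiniteDimensional ℝ (X u) := by
  intro h
  have : ProperSpace (X u) := FiniteDimensional.proper ℝ _
  have h1 : (1 : V →L[ℝ] V) = 0 :=
    eq_zero_of_isCompactOperator_hat (u := u) (fun _ => rfl)
      (isCompactOperator_of_locallyCompactSpace_dom _)
  exact one_ne_zero h1

lemma compactIdeal_ne_bot [FiniteDimensional ℝ V] : compactIdeal (X u) ≠ ⊥ := by
  intro h
  have h1 : P (u := u) 1 ∈ compactIdeal (X u) := mem_compactIdeal.2 (isCompactOperator_P 1)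
  rw [h, TwoSidedIdeal.mem_bot] at h1
  obtain ⟨v, hv⟩ := exists_ne (0 : V)
  have h2 := P_b (u := u) 0 v
  rw [zero_add, h1] at h2
  have h3 := e_b (u := u) 0 v
  rw [← h2, zero_apply, map_zero] at h3
  exact hv h3.symm

end Dimension

lemma isTopologicalRing_clm (E : Type*) [NormedAddCommGroup E] [NormedSpace ℝ E] :
    IsTopologicalRing (E →L[ℝ] E) := inferInstance

end Calkin

open Calkin in
theorem stmt7 (k : ℕ) (hk : 2 ≤ k) :
    ∃ (X : Type) (_ : NormedAddCommGroup X) (_ : NormedSpace ℝ X),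
      CompleteSpace X ∧ TopologicalSpace.SeparableSpace X ∧ ¬FiniteDimensional ℝ X ∧
      IsChain (· ≤ ·)
        {J : TwoSidedIdeal (X →L[ℝ] X) | IsClosed (J : Set (X →L[ℝ] X)) ∧ J ≠ ⊥ ∧ J ≠ ⊤} ∧
      {J : TwoSidedIdeal (X →L[ℝ] X) |
        IsClosed (J : Set (X →L[ℝ] X)) ∧ J ≠ ⊥ ∧ J ≠ ⊤}.ncard = k ∧
      ∃ K : TwoSidedIdeal (X →L[ℝ] X),
        (K : Set (X →L[ℝ] X)) = {T : X →L[ℝ] X | IsCompactOperator T} ∧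
        K ∈ {J : TwoSidedIdeal (X →L[ℝ] X) |
          IsClosed (J : Set (X →L[ℝ] X)) ∧ J ≠ ⊥ ∧ J ≠ ⊤} ∧
        ∀ J ∈ {J : TwoSidedIdeal (X →L[ℝ] X) |
          IsClosed (J : Set (X →L[ℝ] X)) ∧ J ≠ ⊥ ∧ J ≠ ⊤}, K ≤ J := by
  have : Nonempty (Fin k) := ⟨⟨0, by omega⟩⟩
  have hclosed : IsClosed (compactIdeal (X (contraction k)) :
      Set (X (contraction k) →L[ℝ] X (contraction k))) := by
    rw [coe_compactIdeal]
    exact isClosed_setOfPred_isCompactOperator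
  have : IsTopologicalRing (X (contraction k) →L[ℝ] X (contraction k)) :=
    isTopologicalRing_clm _
  have h : ∀ T, ∃ q, T - Polynomial.aeval (hatShift k) q ∈ compactIdeal (X (contraction k)) :=
    exists_sub_aeval_mem
  have hD' := hatShift_pow_notMem (k := k) (by omega)
  refine ⟨X (contraction k), inferInstance, inferInstance, inferInstance, inferInstance,
    not_finiteDimensional, ?_⟩
  rw [setOf_ideals_eq hclosed compactIdeal_ne_bot (fun _ => compactIdeal_le) hatShift_pow_self
    hD' h]
  refine ⟨?_, ?_, compactIdeal _, coe_compactIdeal, ⟨0, by simp; omega, colon_zero h⟩, ?_⟩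
  · rintro _ ⟨r, -, rfl⟩ _ ⟨s, -, rfl⟩ -
    exact (le_total r s).imp (fun hrs => colon_mono h hrs) fun hrs => colon_mono h hrs
  · rw [(injOn_colon hatShift_pow_self hD' h).ncard_image]
    simp [Set.ncard_eq_toFinset_card']
  · rintro _ ⟨r, -, rfl⟩
    exact le_colon h r
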